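/- For every integer q with 1 ≤ q ≤ n, every G-equivariant ℚ-linear endomorphism of Ω^q_{F/k₀,log} is multiplication by a rational number; i.e., End_G(Ω^q_{F/k₀,log}) = ℚ. -/

import Mathlib

/-- The wedge `v 0 ∧ … ∧ v (n-1)` as an element of the `n`-th exterior power. -/
noncomputable def wedge (R M : Type*) [CommRing R] [AddCommGroup M] [Module R M]
    (n : ℕ) (v : Fin n → M) : ↥(⋀[R]^n M) :=
  ⟨ExteriorAlgebra.ιMulti R n v, ExteriorAlgebra.ιMulti_range R n ⟨v, rfl⟩⟩

/-- `Ω^q_{F/k₀,log}`: the `ℚ`-subspace of `Ω^q_{F/k₀} = ⋀^q_F Ω¹_{F/k₀}` spanned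
by the logarithmic forms `(df₁/f₁) ∧ … ∧ (df_q/f_q)`, `f i ∈ F^×` (realized as
the additive subgroup generated by all rational multiples of such forms). -/
noncomputable def logForms (k₀ F : Type*) [Field k₀] [Field F] [Algebra k₀ F]
    (q : ℕ) : AddSubgroup ↥(⋀[F]^q (Ω[F⁄k₀])) :=
  AddSubgroup.closure {ω | ∃ (c : ℚ) (f : Fin q → F), (∀ i, f i ≠ 0) ∧
    ω = (c : F) • wedge F (Ω[F⁄k₀]) q
      (fun i => (f i)⁻¹ • KaehlerDifferential.D k₀ F (f i))}

open IsLocalRing in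
/-- A derivation of the fraction field of a discrete valuation ring `O` with coefficient field `E`,
which has bounded poles on `O`, preserves `E` and rescales a nonzero element `x` of the maximal
ideal, is logarithmic with respect to any uniformizer and preserves `O`. -/
theorem Derivation.mem_range_of_dvr {E O L : Type*} [Field E] [CharZero E] [CommRing O] [IsDomain O]
    [IsDiscreteValuationRing O] [Field L] [Algebra E O] [Algebra O L] [IsFractionRing O L]
    [Algebra E L] [IsScalarTower E O L]
    (hres : ∀ f : O, ∃ a : E, f - algebraMap E O a ∈ maximalIdeal O)
    (D : Derivation ℤ L L) (hE : ∀ a : E, ∃ b : E, D (algebraMap E L a) = algebraMap E L b)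
    {x : O} (hx0 : x ≠ 0) (hx : x ∈ maximalIdeal O) (c : E)
    (hDx : D (algebraMap O L x) = algebraMap E L c * algebraMap O L x)
    (hbd : ∃ d : O, d ≠ 0 ∧ ∀ f : O,
      algebraMap O L d * D (algebraMap O L f) ∈ (algebraMap O L).range)
    {p : O} (hp : Irreducible p) :
    (∃ t : O, D (algebraMap O L p) = algebraMap O L (p * t)) ∧
      ∀ f : O, D (algebraMap O L f) ∈ (algebraMap O L).range := by
  set ι := algebraMap O L with hι
  have hinj : Function.Injective ι := IsFractionRing.injective O L
  have hEO (a : E) : algebraMap E L a = ι (algebraMap E O a) :=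
    IsScalarTower.algebraMap_apply E O L a
  have hp0 : ι p ≠ 0 := by
    simpa using (map_ne_zero_iff ι hinj).2 hp.ne_zero
  have hmem {y : O} : y ∈ maximalIdeal O ↔ ∃ z, y = p * z := by
    rw [hp.maximalIdeal_eq, Ideal.mem_span_singleton]; rfl
  have hstep (f : O) : ∃ f₁ a b : O, D (ι f) = ι a + ι b * D (ι p) + ι p * D (ι f₁) := by
    obtain ⟨a, ha⟩ := hres f
    obtain ⟨f₁, hf₁⟩ := hmem.1 ha
    obtain ⟨b, hb⟩ := hE a
    refine ⟨f₁, algebraMap E O b, f₁, ?_⟩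
    have : ι f = algebraMap E L a + ι p * ι f₁ := by
      rw [hEO, ← map_mul, ← map_add, ← hf₁]; congr 1; ring
    rw [this, map_add, hb, Derivation.leibniz, hEO]
    simp only [smul_eq_mul]; ring
  have hiter (n : ℕ) : ∀ f : O, ∃ f₁ a b : O,
      D (ι f) = ι a + ι b * D (ι p) + ι p ^ n * D (ι f₁) := by
    induction n with
    | zero => exact fun f => ⟨f, 0, 0, by simp⟩
    | succ n ih =>
      intro f
      obtain ⟨f₁, a, b, h⟩ := ih f
      obtain ⟨f₂, a', b', h'⟩ := hstep f₁
      refine ⟨f₂, a + p ^ n * a', b + p ^ n * b', ?_⟩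
      rw [h, h']; simp only [map_add, map_mul, map_pow]; ring
  have hJ (f : O) : ∃ a b : O, D (ι f) = ι a + ι b * D (ι p) := by
    obtain ⟨d, hd0, hd⟩ := hbd
    obtain ⟨n, u, hu⟩ := IsDiscreteValuationRing.eq_unit_mul_pow_irreducible hd0 hp
    obtain ⟨f₁, a, b, h⟩ := hiter n f
    obtain ⟨g, hg⟩ := hd f₁
    refine ⟨a + ↑u⁻¹ * g, b, ?_⟩
    have hg' : ι p ^ n * D (ι f₁) = ι (↑u⁻¹ * g) := by
      rw [map_mul, hg, hu, map_mul, map_pow, ← mul_assoc, ← mul_assoc, ← map_mul]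
      simp
    rw [h, hg', map_add]; ring
  obtain ⟨e, u, hu⟩ := IsDiscreteValuationRing.eq_unit_mul_pow_irreducible hx0 hp
  have he : e ≠ 0 := by
    rintro rfl
    rw [hu] at hx
    exact (mem_maximalIdeal _).1 hx (by simp)
  obtain ⟨e, rfl⟩ := Nat.exists_eq_succ_of_ne_zero he
  obtain ⟨a, b, hab⟩ := hJ u
  have hkey : (ι ((e + 1 : ℕ) * u + p * b)) * D (ι p) = ι (p * (algebraMap E O c * u - a)) := by
    have h1 : D (ι x) = ι p ^ e * (ι p * D (ι u) + (e + 1 : ℕ) * ι u * D (ι p)) := by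
      rw [hu, map_mul, map_pow, Derivation.leibniz, Derivation.leibniz_pow]
      simp only [smul_eq_mul, nsmul_eq_mul, Nat.succ_eq_add_one, Nat.add_sub_cancel]
      ring
    rw [hDx, hu, hab, hEO, map_mul ι _ (p ^ _), map_pow] at h1
    have h2 := mul_left_cancel₀ (pow_ne_zero e hp0) (b := ι p * ι (algebraMap E O c) * ι u)
      (by rw [← h1]; simp only [Nat.succ_eq_add_one]; ring)
    have h3 : ι ((e + 1 : ℕ) : O) = ((e + 1 : ℕ) : L) := by
      push_cast; simp
    simp only [map_add, map_mul, map_sub, h3]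
    linear_combination -h2
  have hunit : IsUnit (((e + 1 : ℕ) : O) * u + p * b) := by
    by_contra hn
    have h1 : ((e + 1 : ℕ) : O) * u ∈ maximalIdeal O := by
      have := Ideal.sub_mem _ ((mem_maximalIdeal _).2 hn) (hmem.2 ⟨b, rfl⟩)
      simpa using this
    refine (mem_maximalIdeal _).1 h1 (IsUnit.mul ?_ u.isUnit)
    have : IsUnit (algebraMap E O ((e + 1 : ℕ) : E)) :=
      (IsUnit.mk0 _ (by exact_mod_cast Nat.succ_ne_zero e)).map _
    simpa using this
  have hDp : ∃ t : O, D (ι p) = ι (p * t) := by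
    obtain ⟨w, hw⟩ := hunit
    rw [← hw] at hkey
    refine ⟨(algebraMap E O c * u - a) * ↑w⁻¹, ?_⟩
    have : ι (w : O) ≠ 0 := (map_ne_zero_iff ι hinj).2 w.ne_zero
    apply mul_left_cancel₀ this
    rw [hkey, ← map_mul]
    congr 1
    have : (w : O) * ↑w⁻¹ = 1 := by simp
    linear_combination (-p * (algebraMap E O c * u - a)) * this
  refine ⟨hDp, fun f => ?_⟩
  obtain ⟨a, b, h⟩ := hJ f
  obtain ⟨t, ht⟩ := hDp
  exact ⟨a + b * (p * t), by rw [h, ht]; simp⟩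

open IsLocalRing in
/-- The logarithmic derivative of an element of the fraction field of a discrete valuation ring
with algebraically closed coefficient field `E` is integral and its residue is, up to a rational
multiple of the weight of `x`, a logarithmic derivative of an element of `E`. -/
theorem exists_residue_logDeriv_of_dvr {E O L : Type*} [Field E] [IsAlgClosed E] [CharZero E]
    [CommRing O] [IsDomain O]
    [IsDiscreteValuationRing O] [Field L] [Algebra E O] [Algebra O L] [IsFractionRing O L]
    [Algebra E L] [IsScalarTower E O L]
    (hres : ∀ f : O, ∃ a : E, f - algebraMap E O a ∈ maximalIdeal O)
    {x : O} (hx0 : x ≠ 0) (hx : x ∈ maximalIdeal O) {f : L} (hf : f ≠ 0) :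
    ∃ (g : E) (s : ℚ), g ≠ 0 ∧ ∀ D : Derivation ℤ L L,
      (∀ a : E, ∃ b : E, D (algebraMap E L a) = algebraMap E L b) →
      (∃ d : O, d ≠ 0 ∧ ∀ f : O,
        algebraMap O L d * D (algebraMap O L f) ∈ (algebraMap O L).range) →
      ∀ c : E, D (algebraMap O L x) = algebraMap E L c * algebraMap O L x →
      ∃ (h : O) (b : E), D f / f = algebraMap O L h ∧
        D (algebraMap E L g) = algebraMap E L b ∧
        h - algebraMap E O (b / g + s * c) ∈ maximalIdeal O := by
  obtain ⟨p, hp⟩ := IsDiscreteValuationRing.exists_irreducible O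
  set ι := algebraMap O L with hι
  have hinj : Function.Injective ι := IsFractionRing.injective O L
  have hEO (a : E) : algebraMap E L a = ι (algebraMap E O a) :=
    IsScalarTower.algebraMap_apply E O L a
  have hp0 : ι p ≠ 0 := by
    simpa using (map_ne_zero_iff ι hinj).2 hp.ne_zero
  have hmem {y : O} : y ∈ maximalIdeal O ↔ ∃ z, y = p * z := by
    rw [hp.maximalIdeal_eq, Ideal.mem_span_singleton]; rfl
  -- `f = u p ^ n` with `n` an integer
  obtain ⟨n, u, hu⟩ : ∃ (n : ℤ) (u : Oˣ), f = ι u * ι p ^ n := by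
    obtain ⟨a, b, hb, rfl⟩ : ∃ a b, b ∈ nonZeroDivisors O ∧ ι a / ι b = f :=
      IsFractionRing.div_surjective O (K := L) f
    have hb0 : b ≠ 0 := nonZeroDivisors.ne_zero hb
    have ha0 : a ≠ 0 := by rintro rfl; simp at hf
    obtain ⟨n, u, rfl⟩ := IsDiscreteValuationRing.eq_unit_mul_pow_irreducible ha0 hp
    obtain ⟨m, v, rfl⟩ := IsDiscreteValuationRing.eq_unit_mul_pow_irreducible hb0 hp
    refine ⟨n - m, u * v⁻¹, ?_⟩
    have h1 : ι (v : O) ≠ 0 := (map_ne_zero_iff ι hinj).2 v.ne_zero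
    have h2 : ι (v : O) * ι ((v⁻¹ : Oˣ) : O) = 1 := by rw [← map_mul]; simp
    rw [zpow_sub₀ hp0, zpow_natCast, zpow_natCast, Units.val_mul, map_mul, map_mul, map_mul,
      map_pow, map_pow, div_eq_iff (mul_ne_zero h1 (pow_ne_zero _ hp0))]
    have h3 : ι p ^ n / ι p ^ m * ι p ^ m = ι p ^ n := div_mul_cancel₀ _ (pow_ne_zero _ hp0)
    linear_combination (-ι (u : O) * ι p ^ n) * h2 -
      ι (u : O) * ι (v : O) * ι ((v⁻¹ : Oˣ) : O) * h3
  obtain ⟨e, v, hv⟩ := IsDiscreteValuationRing.eq_unit_mul_pow_irreducible hx0 hp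
  have he : e ≠ 0 := by
    rintro rfl
    rw [hv] at hx
    exact (mem_maximalIdeal _).1 hx (by simp)
  have heE : (e : E) ≠ 0 := by exact_mod_cast he
  have hunit (w : Oˣ) : ∃ a : E, a ≠ 0 ∧ (w : O) - algebraMap E O a ∈ maximalIdeal O := by
    obtain ⟨a, ha⟩ := hres w
    refine ⟨a, ?_, ha⟩
    rintro rfl
    exact (mem_maximalIdeal _).1 (by simpa only [map_zero, sub_zero] using ha) w.isUnit
  obtain ⟨a, ha0, ha⟩ := hunit u
  obtain ⟨a', ha0', ha'⟩ := hunit v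
  obtain ⟨r, hr⟩ := IsAlgClosed.exists_pow_nat_eq a' (Nat.pos_of_ne_zero he)
  have hr0 : r ≠ 0 := by rintro rfl; rw [zero_pow he] at hr; exact ha0' hr.symm
  refine ⟨a * r ^ (-n), n / e, mul_ne_zero ha0 (zpow_ne_zero _ hr0), ?_⟩
  intro D hE hbd c hc
  obtain ⟨⟨t, ht⟩, hO⟩ := D.mem_range_of_dvr hres hE hx0 hx c hc hbd hp
  obtain ⟨ba, hba⟩ := hE a
  obtain ⟨br, hbr⟩ := hE r
  -- logarithmic derivatives of units
  have hlog (w : Oˣ) (a b : E) (ha0 : a ≠ 0) (ha : (w : O) - algebraMap E O a ∈ maximalIdeal O)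
      (hb : D (algebraMap E L a) = algebraMap E L b) :
      ∃ z : O, D (ι w) = ι w * ι z ∧ z - algebraMap E O (b / a) ∈ maximalIdeal O := by
    obtain ⟨y, hy⟩ := hmem.1 ha
    obtain ⟨z, hz⟩ := hO y
    have hw : (w : O) = algebraMap E O a + p * y := by rw [← hy]; ring
    have hDw : D (ι w) = ι (algebraMap E O b + p * (t * y + z)) := by
      rw [hw, map_add, map_mul, ← hEO, map_add, hb, Derivation.leibniz, ht, ← hz, hEO]
      simp only [smul_eq_mul, map_add, map_mul]; ring
    refine ⟨↑w⁻¹ * (algebraMap E O b + p * (t * y + z)), ?_, ?_⟩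
    · rw [hDw, ← map_mul, ← mul_assoc]; simp
    · have h1 : (↑w⁻¹ : O) * w = 1 := by simp
      have h2 : algebraMap E O (b / a) * algebraMap E O a = algebraMap E O b := by
        rw [← map_mul, div_mul_cancel₀ _ ha0]
      refine hmem.2 ⟨↑w⁻¹ * (t * y + z - algebraMap E O (b / a) * y), ?_⟩
      linear_combination (algebraMap E O (b / a)) * h1 -
        (algebraMap E O (b / a)) * ↑w⁻¹ * hw - ↑w⁻¹ * h2
  obtain ⟨zu, hzu, hzu'⟩ := hlog u a ba ha0 ha hba
  have hba' : D (algebraMap E L a') = algebraMap E L (e * (r ^ (e - 1) * br)) := by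
    rw [← hr, map_pow, Derivation.leibniz_pow, hbr]
    simp
  obtain ⟨zv, hzv, hzv'⟩ := hlog v a' _ ha0' ha' hba'
  have hun0 (w : Oˣ) : ι (w : O) ≠ 0 := (map_ne_zero_iff ι hinj).2 w.ne_zero
  have hzpow (y : L) (hy : y ≠ 0) (m : ℤ) : D (y ^ m) = m * y ^ m * (D y / y) := by
    rw [Derivation.leibniz_zpow]
    simp only [zsmul_eq_mul, smul_eq_mul]
    rw [zpow_sub_one₀ hy]; field_simp
  have hfD : D f / f = ι (zu + n * t) := by
    rw [hu, Derivation.leibniz, hzpow _ hp0, hzu, ht]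
    have := hun0 u
    have := zpow_ne_zero n hp0
    simp only [smul_eq_mul, map_add, map_mul, map_intCast]
    field_simp
    ring
  have hxD : algebraMap E O c = zv + e * t := by
    apply hinj
    have hx0' : ι x ≠ 0 := (map_ne_zero_iff ι hinj).2 hx0
    apply mul_right_cancel₀ hx0'
    rw [← hEO, ← hc, hv, map_mul, map_pow, Derivation.leibniz, ← zpow_natCast, hzpow _ hp0, hzv, ht]
    simp only [smul_eq_mul, map_add, map_mul, map_natCast, Int.cast_natCast]
    field_simp
    ring
  refine ⟨_, ba * r ^ (-n) + a * (-n * r ^ (-n) * (br / r)), hfD, ?_, ?_⟩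
  · have hr0L : algebraMap E L r ≠ 0 := by simpa using hr0
    rw [map_mul, map_zpow₀, Derivation.leibniz, hzpow _ hr0L, hba, hbr]
    simp only [smul_eq_mul, map_add, map_mul, map_neg, map_intCast, map_zpow₀, map_div₀]
    push_cast
    ring
  · have h1 : (ba * r ^ (-n) + a * (-n * r ^ (-n) * (br / r))) / (a * r ^ (-n)) +
        ((n / e : ℚ) : E) * c = ba / a + (n / e : E) * (c - e * (r ^ (e - 1) * br) / a') := by
      have h3 : r ^ (e - 1) = a' / r := by
        rw [← hr, eq_div_iff hr0, ← pow_succ, Nat.sub_add_cancel (Nat.pos_of_ne_zero he)]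
      have h4 := zpow_ne_zero (-n) hr0
      rw [h3]
      push_cast
      field_simp
      ring
    rw [h1]
    have h2 : zu + n * t - algebraMap E O (ba / a + (n / e : E) *
        (c - e * (r ^ (e - 1) * br) / a')) = (zu - algebraMap E O (ba / a)) -
        algebraMap E O (n / e : E) * (zv - algebraMap E O (e * (r ^ (e - 1) * br) / a')) := by
      have h5 : algebraMap E O (n / e : E) * e = n := by
        rw [← map_natCast (algebraMap E O), ← map_mul, div_mul_cancel₀ _ heE, map_intCast]
      rw [map_add, map_mul, map_sub, hxD]
      linear_combination -t * h5
    rw [h2]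
    exact Ideal.sub_mem _ hzu' (Ideal.mul_mem_left _ _ hzv')

open Polynomial IsLocalRing in
theorem exists_place_of_finite {E K L : Type*} [Field E] [IsAlgClosed E] [CharZero E]
    [Field K] [Field L] [Algebra E[X] K] [IsFractionRing E[X] K] [Algebra E[X] L] [Algebra K L]
    [IsScalarTower E[X] K L] [FiniteDimensional K L] [Algebra E L] [IsScalarTower E E[X] L] :
    ∃ (O : Subring L) (r : O →+* E), (∀ a : E, ∃ h : algebraMap E L a ∈ O, r ⟨_, h⟩ = a) ∧
      ∀ f : L, f ≠ 0 → ∃ (g : E) (s : ℚ), g ≠ 0 ∧ ∀ D : Derivation ℤ L L,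
        (∀ a : E, ∃ b : E, D (algebraMap E L a) = algebraMap E L b) →
        ∀ c : E, D (algebraMap E[X] L X) = algebraMap E L c * algebraMap E[X] L X →
        ∃ b : E, D (algebraMap E L g) = algebraMap E L b ∧
          ∃ h : D f / f ∈ O, r ⟨_, h⟩ = b / g + s * c := by
  classical
  have : CharZero K := by
    have h1 : Function.Injective (algebraMap E[X] K) := IsFractionRing.injective _ _
    exact charZero_of_injective_ringHom h1
  have hinjL : Function.Injective (algebraMap E[X] L) := by
    rw [IsScalarTower.algebraMap_eq E[X] K L]
    exact (algebraMap K L).injective.comp (IsFractionRing.injective _ _)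
  let B := integralClosure E[X] L
  have hB1 : IsDedekindDomain B := integralClosure.isDedekindDomain E[X] K L
  have hB2 : Module.Finite E[X] B := IsIntegralClosure.finite E[X] K L B
  have hB3 : IsFractionRing B L := IsIntegralClosure.isFractionRing_of_finite_extension E[X] K L B
  have hBinj : Function.Injective (algebraMap E[X] B) := by
    have : algebraMap E[X] L = (algebraMap B L).comp (algebraMap E[X] B) :=
      IsScalarTower.algebraMap_eq _ _ _
    rw [this, RingHom.coe_comp] at hinjL
    exact Function.Injective.of_comp hinjL
  have hBint : Algebra.IsIntegral E[X] B := inferInstance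
  have hmaxX : (Ideal.span {(X : E[X])}).IsMaximal :=
    PrincipalIdealRing.isMaximal_of_irreducible irreducible_X
  obtain ⟨P, hP, hPX⟩ := Ideal.exists_ideal_over_maximal_of_isIntegral (S := B)
    (Ideal.span {(X : E[X])}) (by
      rw [(RingHom.injective_iff_ker_eq_bot _).1 hBinj]; exact bot_le)
  have hXP : algebraMap E[X] B X ∈ P := by
    have : (X : E[X]) ∈ Ideal.comap (algebraMap E[X] B) P := by
      rw [hPX]; exact Ideal.mem_span_singleton_self _
    exact this
  have hPne : P ≠ ⊥ := by
    rintro rfl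
    rw [Ideal.mem_bot] at hXP
    exact X_ne_zero ((map_eq_zero_iff _ hBinj).1 hXP)
  obtain ⟨O, _, _, hloc⟩ : ∃ (O : Type _) (_ : CommRing O) (_ : Algebra B O),
      IsLocalization.AtPrime O P :=
    ⟨Localization.AtPrime P, inferInstance, inferInstance, inferInstance⟩
  have hPle : P.primeCompl ≤ nonZeroDivisors B := P.primeCompl_le_nonZeroDivisors
  have hdom : IsDomain O := IsLocalization.isDomain_of_le_nonZeroDivisors O hPle
  have hDVR : IsDiscreteValuationRing O :=
    IsLocalization.AtPrime.isDiscreteValuationRing_of_dedekind_domain B hPne O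
  let _ : Algebra O L := IsLocalization.localizationAlgebraOfSubmonoidLe O L P.primeCompl _ hPle
  have hBOL : IsScalarTower B O L :=
    IsLocalization.localization_isScalarTower_of_submonoid_le O L _ _ hPle
  have hfrac : IsFractionRing O L :=
    IsFractionRing.isFractionRing_of_isDomain_of_isLocalization P.primeCompl O L
  have hEBL : IsScalarTower E B L := inferInstance
  let _ : Algebra E O := ((algebraMap B O).comp (algebraMap E B)).toAlgebra
  have hEBO : IsScalarTower E B O := IsScalarTower.of_algebraMap_eq fun _ => rfl
  have hEOL : IsScalarTower E O L := by
    refine IsScalarTower.of_algebraMap_eq fun a => ?_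
    rw [IsScalarTower.algebraMap_apply E B O, ← IsScalarTower.algebraMap_apply B O L,
      ← IsScalarTower.algebraMap_apply E B L]
  have hresB : ∀ f : B, ∃ a : E, f - algebraMap E B a ∈ P := by
    let π : E →+* B ⧸ P := (Ideal.Quotient.mk P).comp (algebraMap E B)
    have hπ : π.comp (evalRingHom 0) = (Ideal.Quotient.mk P).comp (algebraMap E[X] B) := by
      refine Polynomial.ringHom_ext (fun a => ?_) ?_
      · simp only [π, RingHom.comp_apply, coe_evalRingHom, eval_C,
          IsScalarTower.algebraMap_apply E E[X] B, algebraMap_eq]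
      · simpa using (Ideal.Quotient.eq_zero_iff_mem.2 hXP).symm
    have h1 : ((Ideal.Quotient.mk P).comp (algebraMap E[X] B)).IsIntegral :=
      RingHom.IsIntegral.trans _ _ (algebraMap_isIntegral_iff.2 hBint)
        (RingHom.isIntegral_of_surjective _ Ideal.Quotient.mk_surjective)
    rw [← hπ] at h1
    have h2 : π.IsIntegral := RingHom.IsIntegral.tower_top _ _ h1
    intro f
    have h3 := (IsAlgClosed.ringHom_bijective_of_isIntegral π h2).2 (Ideal.Quotient.mk P f)
    obtain ⟨a, ha⟩ := h3
    exact ⟨a, Ideal.Quotient.eq.1 ha.symm⟩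
  have hres : ∀ f : O, ∃ a : E, f - algebraMap E O a ∈ maximalIdeal O := by
    intro f
    obtain ⟨b, hb⟩ := (IsLocalization.AtPrime.equivQuotMaximalIdeal P O).surjective
      (Ideal.Quotient.mk _ f)
    obtain ⟨b, rfl⟩ := Ideal.Quotient.mk_surjective b
    obtain ⟨a, ha⟩ := hresB b
    refine ⟨a, Ideal.Quotient.eq.1 ?_⟩
    rw [← hb, Ideal.Quotient.eq.2 ha, IsLocalization.AtPrime.equivQuotMaximalIdeal_apply_mk,
      IsScalarTower.algebraMap_apply E B O]
  let x : O := algebraMap B O (algebraMap E[X] B X)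
  have hx0 : x ≠ 0 := by
    have h1 : Function.Injective (algebraMap B O) := IsLocalization.injective O hPle
    exact (map_ne_zero_iff _ h1).2 ((map_ne_zero_iff _ hBinj).2 X_ne_zero)
  have hx : x ∈ maximalIdeal O := (IsLocalization.AtPrime.to_map_mem_maximal_iff O P _).2 hXP
  have hxL : algebraMap O L x = algebraMap E[X] L X := by
    rw [← IsScalarTower.algebraMap_apply B O L, ← IsScalarTower.algebraMap_apply E[X] B L]
  have hinjO : Function.Injective (algebraMap O L) := IsFractionRing.injective O L
  -- the residue map
  let π : E →+* O ⧸ maximalIdeal O := (Ideal.Quotient.mk _).comp (algebraMap E O)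
  have hπ : Function.Bijective π := by
    refine ⟨π.injective, fun y => ?_⟩
    obtain ⟨y, rfl⟩ := Ideal.Quotient.mk_surjective y
    obtain ⟨a, ha⟩ := hres y
    exact ⟨a, (Ideal.Quotient.eq.2 ha).symm⟩
  let r₀ : O →+* E := (RingEquiv.ofBijective π hπ).symm.toRingHom.comp
    (Ideal.Quotient.mk (maximalIdeal O))
  have hr₀ (f : O) (a : E) (h : f - algebraMap E O a ∈ maximalIdeal O) : r₀ f = a := by
    change (RingEquiv.ofBijective π hπ).symm _ = a
    rw [RingEquiv.symm_apply_eq]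
    exact Ideal.Quotient.eq.2 h
  let e : O ≃+* (algebraMap O L).range := RingEquiv.ofBijective (algebraMap O L).rangeRestrict
    ⟨fun a b h => hinjO (congrArg Subtype.val h), (algebraMap O L).rangeRestrict_surjective⟩
  have he (f : O) (y : L) (h : y ∈ (algebraMap O L).range) (hy : y = algebraMap O L f) :
      e.symm ⟨y, h⟩ = f := by
    rw [RingEquiv.symm_apply_eq]
    exact Subtype.ext hy
  refine ⟨(algebraMap O L).range, r₀.comp e.symm, fun a => ?_, fun f hf => ?_⟩
  · have h1 := IsScalarTower.algebraMap_apply E O L a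
    refine ⟨⟨_, h1.symm⟩, ?_⟩
    rw [RingHom.comp_apply]
    exact (congrArg r₀ (he _ _ _ h1)).trans (hr₀ _ _ (by simp))
  obtain ⟨g, s, hg, H⟩ := exists_residue_logDeriv_of_dvr (L := L) hres hx0 hx hf
  refine ⟨g, s, hg, fun D hE c hc => ?_⟩
  have hbd : ∃ d : O, d ≠ 0 ∧ ∀ f : O,
      algebraMap O L d * D (algebraMap O L f) ∈ (algebraMap O L).range := by
    have hpoly (p : E[X]) : ∃ p' : E[X], D (algebraMap E[X] L p) = algebraMap E[X] L p' := by
      induction p using Polynomial.induction_on' with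
      | add p p' hp hp' =>
        obtain ⟨a, ha⟩ := hp
        obtain ⟨b, hb⟩ := hp'
        exact ⟨a + b, by rw [map_add, map_add, ha, hb, map_add]⟩
      | monomial n a =>
        obtain ⟨b, hb⟩ := hE a
        have h2 (a : E) : algebraMap E[X] L (C a) = algebraMap E L a := by
          rw [IsScalarTower.algebraMap_apply E E[X] L]; rfl
        refine ⟨C b * X ^ n + C a * ((n : E[X]) * X ^ (n - 1) * (C c * X)), ?_⟩
        rw [← C_mul_X_pow_eq_monomial]
        simp only [map_mul, map_pow, map_add, h2, map_natCast, Derivation.leibniz,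
          Derivation.leibniz_pow, hb, hc, smul_eq_mul, nsmul_eq_mul]
        ring
    obtain ⟨S, hS⟩ := hB2
    obtain ⟨d, hd⟩ := IsLocalization.exist_integer_multiples_of_finset (nonZeroDivisors B)
      (S.image fun b => D (algebraMap B L b))
    have hdB (y : B) : ∃ z : B, algebraMap B L d * D (algebraMap B L y) = algebraMap B L z := by
      have hy : y ∈ Submodule.span E[X] (S : Set B) := by rw [hS]; trivial
      induction hy using Submodule.span_induction with
      | mem y hy =>
        obtain ⟨z, hz⟩ := hd _ (Finset.mem_image_of_mem _ hy)
        exact ⟨z, by rw [hz, Algebra.smul_def]⟩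
      | zero => exact ⟨0, by simp⟩
      | add y y' _ _ hy hy' =>
        obtain ⟨a, ha⟩ := hy
        obtain ⟨b, hb⟩ := hy'
        exact ⟨a + b, by rw [map_add, map_add, mul_add, ha, hb, map_add]⟩
      | smul p y _ hy =>
        obtain ⟨z, hz⟩ := hy
        obtain ⟨p', hp'⟩ := hpoly p
        have h2 (p : E[X]) : algebraMap B L (algebraMap E[X] B p) = algebraMap E[X] L p :=
          (IsScalarTower.algebraMap_apply E[X] B L p).symm
        refine ⟨algebraMap E[X] B p * z + d * y * algebraMap E[X] B p', ?_⟩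
        rw [Algebra.smul_def]
        simp only [map_mul, map_add, Derivation.leibniz, h2, hp', ← hz, smul_eq_mul]
        ring
    have hBO (b : B) : algebraMap O L (algebraMap B O b) = algebraMap B L b :=
      (IsScalarTower.algebraMap_apply B O L b).symm
    refine ⟨algebraMap B O d, ?_, fun f => ?_⟩
    · have h1 : Function.Injective (algebraMap B O) := IsLocalization.injective O hPle
      exact (map_ne_zero_iff _ h1).2 (nonZeroDivisors.coe_ne_zero d)
    · obtain ⟨⟨b, t⟩, hbt⟩ := IsLocalization.surj P.primeCompl f
      obtain ⟨u, hu⟩ := IsLocalization.map_units O t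
      simp only at hbt
      rw [← hu] at hbt
      have hf : f = algebraMap B O b * ↑u⁻¹ := by rw [← hbt]; simp
      obtain ⟨z, hz⟩ := hdB b
      obtain ⟨w, hw⟩ := hdB t
      have h3 : D (algebraMap O L f) * algebraMap O L u + algebraMap O L f * D (algebraMap B L t) =
          D (algebraMap B L b) := by
        rw [← hBO b, ← hbt, map_mul, Derivation.leibniz, ← hBO t, ← hu]
        simp only [smul_eq_mul]; ring
      have h4 : algebraMap O L u * algebraMap O L ↑u⁻¹ = 1 := by rw [← map_mul]; simp
      refine ⟨(algebraMap B O z - f * algebraMap B O w) * ↑u⁻¹, ?_⟩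
      rw [map_mul, map_sub, map_mul, hBO, hBO, hBO, ← hz, ← hw, ← h3]
      linear_combination (algebraMap B L d * D (algebraMap O L f)) * h4
  obtain ⟨h, b, hh, hb, hm⟩ := H D hE hbd c (by rw [hxL, hc])
  refine ⟨b, hb, ⟨h, hh.symm⟩, ?_⟩
  rw [RingHom.comp_apply]
  exact (congrArg r₀ (he _ _ _ hh)).trans (hr₀ _ _ hm)

open Polynomial in
theorem Derivation.mem_of_isAlgebraic {F : Type*} [Field F] [CharZero F] (D : Derivation ℤ F F)
    {T M : Subfield F} (hTM : T ≤ M) (N : Submodule M F) (hD : ∀ a ∈ T, D a ∈ N) {f : F}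
    (hf : IsAlgebraic T f) (hfM : f ∈ M) : D f ∈ N := by
  have hM (p : T[X]) : aeval f p ∈ M := by
    rw [aeval_eq_sum_range]
    exact sum_mem fun i _ => mul_mem (hTM (p.coeff i).2) (pow_mem hfM i)
  have key (p : T[X]) : D (aeval f p) - aeval f (derivative p) * D f ∈ N := by
    induction p using Polynomial.induction_on' with
    | add p p' hp hp' =>
      convert N.add_mem hp hp' using 1
      simp only [map_add]; ring
    | monomial n a =>
      have h1 : algebraMap T F a = a := rfl
      convert N.smul_mem (⟨f ^ n, pow_mem hfM n⟩ : M) (hD a a.2) using 1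
      rw [aeval_monomial, derivative_monomial, aeval_monomial, Derivation.leibniz,
        Derivation.leibniz_pow, Subfield.smul_def, map_mul, h1]
      have h2 : algebraMap T F (n : T) = n := by simp
      simp only [smul_eq_mul, nsmul_eq_mul, h2]
      ring
  have h1 := key (minpoly T f)
  rw [minpoly.aeval, map_zero, zero_sub, N.neg_mem_iff] at h1
  have h2 : aeval f (derivative (minpoly T f)) ≠ 0 :=
    (minpoly.irreducible hf.isIntegral).separable.aeval_derivative_ne_zero (minpoly.aeval T f)
  have h3 := N.smul_mem (⟨_, inv_mem (hM (derivative (minpoly T f)))⟩ : M) h1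
  rwa [Subfield.smul_def, smul_eq_mul, ← mul_assoc, inv_mul_cancel₀ h2, one_mul] at h3

open Polynomial in
theorem exists_place_of_transcendental {F : Type*} [Field F] [CharZero F] (E : Subfield F)
    [IsAlgClosed E] {x : F} (hx : Transcendental E x) {S : Set F} (hS : S.Finite)
    (hSx : ∀ f ∈ S, ∀ T : Subfield F, E ≤ T → x ∈ T → IsAlgebraic T f) (hS0 : ∀ f ∈ S, f ≠ 0) :
    ∃ (O : Subring F) (r : O →+* F), (∀ a : O, r a ∈ E) ∧
      (∀ a ∈ E, ∃ h : a ∈ O, r ⟨a, h⟩ = a) ∧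
      ∀ f ∈ S, ∃ g ∈ E, ∃ s : ℚ, g ≠ 0 ∧ ∀ D : Derivation ℤ F F, (∀ a ∈ E, D a ∈ E) →
        ∀ c ∈ E, D x = c * x → ∃ h : D f / f ∈ O, r ⟨_, h⟩ = D g / g + s * c := by
  let K := FractionRing E[X]
  let _ : Algebra E[X] F := (aeval x).toAlgebra
  have hmap (p : E[X]) : algebraMap E[X] F p = aeval x p := rfl
  have hinj : Function.Injective (algebraMap E[X] F) := transcendental_iff_injective.1 hx
  have hfs : FaithfulSMul E[X] F := (faithfulSMul_iff_algebraMap_injective _ _).2 hinj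
  have htow : IsScalarTower E E[X] F := IsScalarTower.of_algebraMap_eq fun a => by
    rw [hmap]; simp
  let _ : Algebra K F := FractionRing.liftAlgebra E[X] F
  have hKF : IsScalarTower E[X] K F := FractionRing.isScalarTower_liftAlgebra E[X] F
  have hSK : ∀ f ∈ S, IsIntegral K f := by
    intro f hf
    have hEK (p : E[X]) : aeval x p ∈ (algebraMap K F).fieldRange :=
      ⟨algebraMap E[X] K p, (IsScalarTower.algebraMap_apply E[X] K F p).symm⟩
    have h1 := hSx f hf (algebraMap K F).fieldRange
      (fun a ha => by
        have := hEK (C ⟨a, ha⟩)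
        rwa [aeval_C] at this) (by simpa using hEK X)
    have h2 : IsAlgebraic K f :=
      IsAlgebraic.of_ringHom_of_comp_eq (algebraMap K F).rangeRestrictField (RingHom.id F)
        (a := f) h1 (algebraMap K F).rangeRestrictField_bijective.2 Function.injective_id
        (RingHom.ext fun _ => rfl)
    exact h2.isIntegral
  let L := IntermediateField.adjoin K S
  have : Finite S := hS
  have hfin : FiniteDimensional K L := IntermediateField.finiteDimensional_adjoin hSK
  let _ : Algebra E L := ((algebraMap E[X] L).comp (algebraMap E E[X])).toAlgebra
  have htow' : IsScalarTower E E[X] L := IsScalarTower.of_algebraMap_eq fun _ => rfl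
  have hEX (p : E[X]) : (algebraMap E[X] L p : F) = aeval x p := by
    have : algebraMap L F (algebraMap E[X] L p) = algebraMap E[X] F p := by
      rw [IsScalarTower.algebraMap_apply E[X] K L, IsScalarTower.algebraMap_apply E[X] K F,
        ← IsScalarTower.algebraMap_apply K L F]
    exact this
  have hE (a : E) : (algebraMap E L a : F) = a := by
    rw [IsScalarTower.algebraMap_apply E E[X] L, hEX, algebraMap_eq, aeval_C]; rfl
  have hX : (algebraMap E[X] L X : F) = x := by
    rw [hEX, aeval_X]
  obtain ⟨O, r, hr, H⟩ := exists_place_of_finite (E := E) (K := K) (L := L)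
  have hDL (D : Derivation ℤ F F) (hDE : ∀ a ∈ E, D a ∈ E) (c : F) (hc : c ∈ E)
      (hDx : D x = c * x) (f : F) (hf : f ∈ L) : D f ∈ L := by
    let T : Subfield F := (algebraMap K F).fieldRange
    have hTL : T ≤ L.toSubfield := by
      rintro _ ⟨y, rfl⟩
      exact L.algebraMap_mem y
    have hEL {a : F} (ha : a ∈ E) : a ∈ L := by
      have h := SetLike.coe_mem (algebraMap E L ⟨a, ha⟩)
      rwa [hE] at h
    have hxL : x ∈ L := by
      rw [← hX]; exact SetLike.coe_mem _
    have hpL (p : E[X]) : aeval x p ∈ L := by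
      rw [← hEX]; exact SetLike.coe_mem _
    have hDp (p : E[X]) : D (aeval x p) ∈ L := by
      induction p using Polynomial.induction_on' with
      | add p p' hp hp' =>
        simp only [map_add]; exact add_mem hp hp'
      | monomial n a =>
        have h1 : algebraMap E F a = a := rfl
        rw [aeval_monomial, h1, Derivation.leibniz, Derivation.leibniz_pow, hDx]
        simp only [smul_eq_mul, nsmul_eq_mul]
        exact add_mem (mul_mem (hEL a.2) (mul_mem (natCast_mem _ _) (mul_mem (pow_mem hxL _)
          (mul_mem (hEL hc) hxL)))) (mul_mem (pow_mem hxL _) (hEL (hDE _ a.2)))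
    let N : Submodule L.toSubfield F :=
      { carrier := L
        add_mem' := add_mem
        zero_mem' := zero_mem _
        smul_mem' := fun a b hb => mul_mem (show (a : F) ∈ L from a.2) hb }
    refine D.mem_of_isAlgebraic hTL N ?_ ?_ hf
    · rintro _ ⟨y, rfl⟩
      obtain ⟨a, b, hb, rfl⟩ := IsFractionRing.div_surjective E[X] y
      have h1 (p : E[X]) : algebraMap K F (algebraMap E[X] K p) = aeval x p :=
        (IsScalarTower.algebraMap_apply E[X] K F p).symm
      change D _ ∈ L
      rw [map_div₀, h1, h1, Derivation.leibniz_div]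
      simp only [smul_eq_mul]
      exact mul_mem (pow_mem (inv_mem (hpL b)) 2)
        (sub_mem (mul_mem (hpL _) (hDp _)) (mul_mem (hpL _) (hDp _)))
    · have h1 : IsAlgebraic K f := by
        have := Algebra.IsAlgebraic.isAlgebraic (R := K) (⟨f, hf⟩ : L)
        exact this.algebraMap (A := F)
      exact h1.ringHom_of_comp_eq (algebraMap K F).rangeRestrictField (RingHom.id F)
        (algebraMap K F).rangeRestrictField.injective (RingHom.ext fun _ => rfl)
  let e : O ≃+* O.map (algebraMap L F) :=
    O.equivMapOfInjective (algebraMap L F) (algebraMap L F).injective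
  have he (f : L) (hf : f ∈ O) (h : (f : F) ∈ O.map (algebraMap L F)) :
      e.symm ⟨f, h⟩ = ⟨f, hf⟩ := by
    rw [RingEquiv.symm_apply_eq]; rfl
  refine ⟨O.map (algebraMap L F), (E.subtype.comp r).comp e.symm.toRingHom,
    fun a => SetLike.coe_mem _, fun a ha => ?_, fun f hf => ?_⟩
  · obtain ⟨h, h'⟩ := hr ⟨a, ha⟩
    have h1 : (algebraMap E L ⟨a, ha⟩ : F) ∈ O.map (algebraMap L F) := ⟨_, h, rfl⟩
    have h2 : (r (e.symm ⟨_, h1⟩) : F) = a := by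
      rw [he _ h h1, h']
    have h3 : (algebraMap E L ⟨a, ha⟩ : F) = a := hE ⟨a, ha⟩
    refine ⟨h3 ▸ h1, ?_⟩
    convert h2 using 1
    change (r (e.symm _) : F) = _
    simp only [h3]
  · have hfL : f ∈ L := IntermediateField.subset_adjoin _ _ hf
    obtain ⟨g, s, hg, hH⟩ := H ⟨f, hfL⟩ (fun h => hS0 f hf (congrArg Subtype.val h))
    refine ⟨g, g.2, s, by simpa using hg, fun D hDE c hc hDx => ?_⟩
    let D' : Derivation ℤ L L := Derivation.mk'
      (AddMonoidHom.toIntLinearMap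
        { toFun := fun y => ⟨D y, hDL D hDE c hc hDx y y.2⟩
          map_zero' := by apply Subtype.ext; simp
          map_add' := by intro a b; apply Subtype.ext; simp })
      (by intro a b; apply Subtype.ext; simp)
    have hD' (y : L) : (D' y : F) = D y := rfl
    obtain ⟨b, hb, h, hrb⟩ := hH D' (fun a => ⟨⟨D a, hDE a a.2⟩, by
      apply Subtype.ext; rw [hD', hE, hE]⟩) ⟨c, hc⟩ (by
      apply Subtype.ext; rw [hD', hX, hDx, L.coe_mul, hE, hX])
    have hb' : D g = b := by
      rw [← hE g, ← hD', hb, hE]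
    have h1 : ((D' ⟨f, hfL⟩ / ⟨f, hfL⟩ : L) : F) ∈ O.map (algebraMap L F) := ⟨_, h, rfl⟩
    refine ⟨h1, ?_⟩
    change (r (e.symm ⟨_, h1⟩) : F) = _
    rw [he _ h h1, hrb, hb']
    simp

/-- The relative algebraic closure in `F` of the subfield generated by `S` over `k`. -/
noncomputable def aclAdjoin (k : Type*) {F : Type*} [Field k] [Field F] [Algebra k F]
    (S : Set F) : Subfield F :=
  (algebraicClosure (IntermediateField.adjoin k S) F).toSubfield

section aclAdjoin

variable {k F : Type*} [Field k] [Field F] [Algebra k F]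

theorem mem_aclAdjoin {S : Set F} {f : F} :
    f ∈ aclAdjoin k S ↔ IsAlgebraic (IntermediateField.adjoin k S) f :=
  mem_algebraicClosure_iff

instance [IsAlgClosed F] (S : Set F) : IsAlgClosed (aclAdjoin k S) :=
  IsAlgClosure.isAlgClosed (R := IntermediateField.adjoin k S)
    (K := algebraicClosure (IntermediateField.adjoin k S) F)

theorem adjoin_le_aclAdjoin (S : Set F) :
    (IntermediateField.adjoin k S).toSubfield ≤ aclAdjoin k S :=
  fun f hf => mem_aclAdjoin.2
    (isAlgebraic_algebraMap (A := F) (⟨f, hf⟩ : IntermediateField.adjoin k S))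

theorem subset_aclAdjoin (S : Set F) : S ⊆ aclAdjoin k S :=
  fun _ hf => adjoin_le_aclAdjoin S (IntermediateField.subset_adjoin k S hf)

theorem algebraMap_mem_aclAdjoin (S : Set F) (a : k) : algebraMap k F a ∈ aclAdjoin k S :=
  adjoin_le_aclAdjoin S ((IntermediateField.adjoin k S).algebraMap_mem a)

theorem isAlgebraic_of_mem_aclAdjoin {S : Set F} {f : F} (hf : f ∈ aclAdjoin k S)
    {T : Subfield F} (hk : ∀ a : k, algebraMap k F a ∈ T) (hS : S ⊆ T) : IsAlgebraic T f := by
  let T' : IntermediateField k F := { T with algebraMap_mem' := hk }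
  have h : IntermediateField.adjoin k S ≤ T' := IntermediateField.adjoin_le_iff.2 hS
  exact (mem_aclAdjoin.1 hf).ringHom_of_comp_eq (IntermediateField.inclusion h).toRingHom
    (RingHom.id F) (IntermediateField.inclusion h).injective (RingHom.ext fun _ => rfl) (S := T)

theorem mem_aclAdjoin_of_isAlgebraic {S : Set F} {f : F} (hf : IsAlgebraic (aclAdjoin k S) f) :
    f ∈ aclAdjoin k S := by
  by_contra h
  rw [mem_aclAdjoin] at h
  exact Transcendental.algebraicClosure h hf

theorem aclAdjoin_mono {S T : Set F} (h : S ⊆ T) :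
    aclAdjoin k S ≤ aclAdjoin k T := by
  intro f hf
  exact mem_aclAdjoin_of_isAlgebraic (isAlgebraic_of_mem_aclAdjoin hf (algebraMap_mem_aclAdjoin T)
    (h.trans (subset_aclAdjoin T)))

theorem Derivation.mem_of_mem_aclAdjoin [CharZero F] (D : Derivation ℤ F F) (S : Set F)
    (N : Submodule (aclAdjoin k S) F) (hk : ∀ a : k, D (algebraMap k F a) = 0)
    (hS : ∀ f ∈ S, D f ∈ N) {f : F} (hf : f ∈ aclAdjoin k S) : D f ∈ N := by
  refine D.mem_of_isAlgebraic (T := (IntermediateField.adjoin k S).toSubfield)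
    (adjoin_le_aclAdjoin S) N (fun a ha => ?_) (mem_aclAdjoin.1 hf) hf
  have hmul {a b : F} (ha : a ∈ aclAdjoin k S) (hb : b ∈ N) : a * b ∈ N :=
    N.smul_mem (⟨a, ha⟩ : aclAdjoin k S) hb
  change a ∈ IntermediateField.adjoin k S at ha
  induction ha using IntermediateField.adjoin_induction with
  | mem a ha => exact hS a ha
  | algebraMap a => rw [hk]; exact zero_mem _
  | add a b _ _ ha hb => rw [map_add]; exact add_mem ha hb
  | inv a h ha =>
    rw [Derivation.leibniz_inv, smul_eq_mul]
    exact hmul (neg_mem (pow_mem (inv_mem (adjoin_le_aclAdjoin S h)) 2)) ha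
  | mul a b h h' ha hb =>
    rw [Derivation.leibniz, smul_eq_mul, smul_eq_mul]
    exact add_mem (hmul (adjoin_le_aclAdjoin S h) hb) (hmul (adjoin_le_aclAdjoin S h') ha)

theorem AlgebraicIndependent.notMem_aclAdjoin {ι : Type*} {z : ι → F}
    (hz : AlgebraicIndependent k z) {A : Set ι} {i : ι} (hi : i ∉ A) :
    z i ∉ aclAdjoin k (z '' A) := by
  rw [mem_aclAdjoin, IntermediateField.isAlgebraic_adjoin_iff]
  exact hz.transcendental_adjoin hi

theorem exists_rational_place [CharZero F] [IsAlgClosed F] {ι : Type*} {z : ι → F}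
    (hz : AlgebraicIndependent k z) (A : Set ι) (J : Finset ι) (hAJ : Disjoint A J)
    {S : Set F} (hfin : S.Finite) (hS : S ⊆ aclAdjoin k (z '' (A ∪ J))) (hS0 : ∀ f ∈ S, f ≠ 0) :
    ∃ (O : Subring F) (r : O →+* F), (∀ a ∈ aclAdjoin k (z '' A), ∃ h : a ∈ O, r ⟨a, h⟩ = a) ∧
      ∀ f ∈ S, ∀ D : Derivation ℤ F F, (∀ a : k, D (algebraMap k F a) = 0) →
        (∀ i ∈ A, D (z i) = 0) → (∀ i, ∃ c : ℚ, D (z i) = c * z i) →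
        ∃ (h : D f / f ∈ O) (c : ℚ), r ⟨_, h⟩ = c := by
  classical
  induction J using Finset.induction_on generalizing S with
  | empty =>
    refine ⟨⊤, (⊤ : Subring F).subtype, fun a _ => ⟨trivial, rfl⟩, fun f hf D hk hA _ =>
      ⟨trivial, 0, ?_⟩⟩
    have h : D f ∈ (⊥ : Submodule (aclAdjoin k (z '' A)) F) := by
      refine D.mem_of_mem_aclAdjoin _ _ hk ?_ (by simpa using hS hf)
      rintro _ ⟨i, hi, rfl⟩
      simpa using hA i hi
    simp only [Submodule.mem_bot] at h
    simp [h]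
  | insert j J hj ih =>
    have hjA : j ∉ A := fun h => Set.disjoint_left.1 hAJ h (by simp)
    have hsub : z '' (A ∪ J) ⊆ z '' (A ∪ (insert j J : Finset ι)) := by
      apply Set.image_mono; intro a; simp; tauto
    obtain ⟨O₁, r₁, hr₁E, hr₁, H₁⟩ := exists_place_of_transcendental (aclAdjoin k (z '' (A ∪ J)))
      (x := z j) (fun h => hz.notMem_aclAdjoin (A := A ∪ J) (by simp [hj, hjA])
        (mem_aclAdjoin_of_isAlgebraic h)) hfin
      (fun f hf T hT hjT => isAlgebraic_of_mem_aclAdjoin (hS hf)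
        (fun a => hT (algebraMap_mem_aclAdjoin _ a)) (by
          rintro _ ⟨i, hi, rfl⟩
          by_cases hij : i = j
          · rwa [hij]
          · exact hT (subset_aclAdjoin _ ⟨i, by simpa [hij] using hi, rfl⟩))) hS0
    choose! g hgE s hg0 hg using H₁
    obtain ⟨O₂, r₂, hr₂, H₂⟩ := ih (S := g '' S)
      (hAJ.mono_right (by simp)) (hfin.image g)
      (by rintro _ ⟨f, hf, rfl⟩; exact hgE f hf) (by rintro _ ⟨f, hf, rfl⟩; exact hg0 f hf)
    let O : Subring F := (O₂.comap r₁).map O₁.subtype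
    let e := (O₂.comap r₁).equivMapOfInjective O₁.subtype Subtype.val_injective
    have hO {a : F} (h : a ∈ O₁) (h' : r₁ ⟨a, h⟩ ∈ O₂) : a ∈ O := ⟨⟨a, h⟩, h', rfl⟩
    have he {a : F} (h : a ∈ O₁) (h' : r₁ ⟨a, h⟩ ∈ O₂) : e.symm ⟨a, hO h h'⟩ = ⟨⟨a, h⟩, h'⟩ := by
      rw [RingEquiv.symm_apply_eq]; rfl
    let r₁' : O₂.comap r₁ →+* O₂ := r₁.restrict _ _ fun a ha => ha
    have hr {a : F} (h : a ∈ O₁) (h' : r₁ ⟨a, h⟩ ∈ O₂) :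
        r₂ (r₁' (e.symm ⟨a, hO h h'⟩)) = r₂ ⟨r₁ ⟨a, h⟩, h'⟩ := by
      rw [he h h']; rfl
    refine ⟨O, (r₂.comp r₁').comp e.symm.toRingHom, fun a ha => ?_, fun f hf D hk hA hD => ?_⟩
    · obtain ⟨h, h'⟩ := hr₁ a (aclAdjoin_mono (Set.image_mono Set.subset_union_left) ha)
      obtain ⟨h₂, h₂'⟩ := hr₂ a ha
      refine ⟨hO h (h'.symm ▸ h₂), (hr h (h'.symm ▸ h₂)).trans ?_⟩
      simp only [h', h₂']
    · obtain ⟨c, hc⟩ := hD j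
      have hDE : ∀ a ∈ aclAdjoin k (z '' (A ∪ J)), D a ∈ aclAdjoin k (z '' (A ∪ J)) := by
        intro a ha
        let N : Submodule (aclAdjoin k (z '' (A ∪ J))) F :=
          { carrier := aclAdjoin k (z '' (A ∪ J))
            add_mem' := add_mem
            zero_mem' := zero_mem _
            smul_mem' := fun a b hb => mul_mem a.2 hb }
        refine D.mem_of_mem_aclAdjoin _ N hk ?_ ha
        rintro _ ⟨i, hi, rfl⟩
        obtain ⟨c, hc⟩ := hD i
        rw [hc]
        change _ ∈ aclAdjoin k (z '' (A ∪ J))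
        exact mul_mem (SubfieldClass.ratCast_mem _ c) (subset_aclAdjoin _ ⟨i, hi, rfl⟩)
      obtain ⟨h₁, h₁'⟩ := hg f hf D hDE c (SubfieldClass.ratCast_mem _ c) hc
      obtain ⟨h₂, c', h₂'⟩ := H₂ (g f) ⟨f, hf, rfl⟩ D hk hA hD
      have hQ (c : ℚ) : ∃ h : (c : F) ∈ O₂, r₂ ⟨c, h⟩ = c := hr₂ c (SubfieldClass.ratCast_mem _ c)
      obtain ⟨h₃, h₃'⟩ := hQ (s f * c)
      have h₄ : r₁ ⟨_, h₁⟩ ∈ O₂ := by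
        rw [h₁']; exact add_mem h₂ (by exact_mod_cast h₃)
      refine ⟨hO h₁ h₄, c' + s f * c, (hr h₁ h₄).trans ?_⟩
      have h₅ : (⟨r₁ ⟨_, h₁⟩, h₄⟩ : O₂) = ⟨_, h₂⟩ + ⟨_, h₃⟩ := by
        apply Subtype.ext
        simp [h₁']
      rw [h₅, map_add, h₂', h₃']
      push_cast; rfl

end aclAdjoin

section Automorphisms

variable {k F ι : Type*} [Field k] [Field F] [Algebra k F]

open MvPolynomial in
theorem IsTranscendenceBasis.exists_algEquiv [IsAlgClosed F] {z w : ι → F}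
    (hz : IsTranscendenceBasis k z) (hw : IsTranscendenceBasis k w) :
    ∃ σ : F ≃ₐ[k] F, ∀ i, σ (z i) = w i := by
  have := IsAlgClosed.isAlgClosure_of_transcendence_basis z hz
  have := IsAlgClosed.isAlgClosure_of_transcendence_basis w hw
  let e := hz.1.aevalEquiv.symm.trans hw.1.aevalEquiv
  let σ := IsAlgClosure.equivOfEquiv F F e.toRingEquiv
  have hσ (p : MvPolynomial ι k) : σ (aeval z p) = aeval w p := by
    rw [← hz.1.algebraMap_aevalEquiv, ← hw.1.algebraMap_aevalEquiv]
    refine (IsAlgClosure.equivOfEquiv_algebraMap F F e.toRingEquiv _).trans ?_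
    change algebraMap _ F (hw.1.aevalEquiv (hz.1.aevalEquiv.symm _)) = _
    rw [AlgEquiv.symm_apply_apply]
  refine ⟨AlgEquiv.ofRingEquiv (f := σ) fun a => ?_, fun i => ?_⟩
  · simpa using hσ (C a)
  · simpa using hσ (X i)

theorem isTranscendenceBasis_iff_aclAdjoin_eq_top {z : ι → F} :
    IsTranscendenceBasis k z ↔
      AlgebraicIndependent k z ∧ aclAdjoin k (Set.range z) = ⊤ := by
  rw [isTranscendenceBasis_iff_algebraicIndependent_isAlgebraic]
  refine and_congr_right fun _ => ?_
  rw [← IntermediateField.isAlgebraic_adjoin_iff_top, Algebra.isAlgebraic_def, eq_top_iff]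
  exact ⟨fun h f _ => mem_aclAdjoin.2 (h f), fun h f => mem_aclAdjoin.1 (h trivial)⟩

theorem IsTranscendenceBasis.exists_algEquiv_update [IsAlgClosed F] {z : ι → F}
    (hz : IsTranscendenceBasis k z) (b : ι) {u : F} (hu : u ∉ aclAdjoin k (z '' {b}ᶜ))
    (hb : z b ∈ aclAdjoin k {u}) :
    ∃ σ : F ≃ₐ[k] F, σ (z b) = u ∧ ∀ i ≠ b, σ (z i) = z i := by
  classical
  have himg : Function.update z b u '' {b}ᶜ = z '' {b}ᶜ :=
    Set.image_congr fun i hi => Function.update_of_ne hi _ _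
  have hw : IsTranscendenceBasis k (Function.update z b u) := by
    rw [isTranscendenceBasis_iff_aclAdjoin_eq_top] at hz ⊢
    refine ⟨(AlgebraicIndependent.iff_transcendental_adjoin_image b).2 ⟨?_, ?_⟩, ?_⟩
    · convert ((AlgebraicIndependent.iff_transcendental_adjoin_image b).1 hz.1).1 using 2 with j
      exact Function.update_of_ne j.2 _ _
    · rw [himg, Function.update_self]
      rwa [mem_aclAdjoin, IntermediateField.isAlgebraic_adjoin_iff] at hu
    · rw [eq_top_iff, ← hz.2]
      intro f hf
      refine mem_aclAdjoin_of_isAlgebraic (isAlgebraic_of_mem_aclAdjoin hf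
        (algebraMap_mem_aclAdjoin _) ?_)
      rintro _ ⟨i, rfl⟩
      by_cases hi : i = b
      · subst hi
        exact aclAdjoin_mono (S := {u})
          (Set.singleton_subset_iff.2 (Set.mem_range.2 ⟨i, Function.update_self _ _ _⟩)) hb
      · exact subset_aclAdjoin _ ⟨i, Function.update_of_ne hi _ _⟩
  obtain ⟨σ, hσ⟩ := hz.exists_algEquiv hw
  refine ⟨σ, by simpa using hσ b, fun i hi => ?_⟩
  rw [hσ, Function.update_of_ne hi]

theorem IsTranscendenceBasis.exists_algEquiv_two_mul [IsAlgClosed F] [CharZero F] {z : ι → F}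
    (hz : IsTranscendenceBasis k z) (b : ι) :
    ∃ σ : F ≃ₐ[k] F, σ (z b) = 2 * z b ∧ ∀ i ≠ b, σ (z i) = z i := by
  have h2 (S : Set F) : (2⁻¹ : F) ∈ aclAdjoin k S :=
    inv_mem (by exact_mod_cast natCast_mem (aclAdjoin k S) 2)
  have h (S : Set F) (h : 2 * z b ∈ aclAdjoin k S) : z b ∈ aclAdjoin k S := by
    simpa using mul_mem (h2 S) h
  exact hz.exists_algEquiv_update b (fun h' => hz.1.notMem_aclAdjoin (by simp) (h _ h'))
    (h _ (subset_aclAdjoin _ rfl))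

theorem IsTranscendenceBasis.exists_algEquiv_sq [IsAlgClosed F] {z : ι → F}
    (hz : IsTranscendenceBasis k z) (b : ι) :
    ∃ σ : F ≃ₐ[k] F, σ (z b) = z b ^ 2 ∧ ∀ i ≠ b, σ (z i) = z i := by
  have h (S : Set F) (h : z b ^ 2 ∈ aclAdjoin k S) : z b ∈ aclAdjoin k S :=
    mem_aclAdjoin_of_isAlgebraic (IsAlgebraic.of_pow two_pos
      (isAlgebraic_algebraMap (⟨_, h⟩ : aclAdjoin k S)))
  exact hz.exists_algEquiv_update b (fun h' => hz.1.notMem_aclAdjoin (by simp) (h _ h'))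
    (h _ (subset_aclAdjoin _ rfl))

open Polynomial in
theorem IsTranscendenceBasis.mem_range_algebraMap [IsAlgClosed k] [CharZero F] {z : ι → F}
    (hz : IsTranscendenceBasis k z) {g : F}
    (hg : ∀ b, ∃ σ : F ≃ₐ[k] F, σ (z b) = 2 * z b ∧ (∀ i ≠ b, σ (z i) = z i) ∧ σ g = g) :
    g ∈ (algebraMap k F).range := by
  by_contra hgk
  have hgt : Transcendental k g := fun h => hgk <| minpoly.mem_range_of_degree_eq_one k g <|
    IsAlgClosed.degree_eq_one_of_irreducible k (minpoly.irreducible h.isIntegral)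
  have hz0 (b : ι) : z b ≠ 0 := hz.1.ne_zero b
  have halg : Algebra.IsAlgebraic (Algebra.adjoin k ({g} ∪ Set.range z)) F := by
    have h1 := hz.isAlgebraic
    exact ⟨fun f => (h1.1 f).tower_top_of_subalgebra_le
      (Algebra.adjoin_mono Set.subset_union_right)⟩
  obtain ⟨u, hgu, huz, hu⟩ := exists_isTranscendenceBasis_between (R := k) {g} ({g} ∪ Set.range z)
    Set.subset_union_left ((algebraicIndependent_singleton_iff (⟨g, rfl⟩ : ({g} : Set F))).2 hgt)
  obtain ⟨b, hb⟩ : ∃ b, z b ∉ u := by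
    by_contra! hc
    have h1 := hz.2 u hu.1 (by rintro _ ⟨i, rfl⟩; exact hc i)
    rw [← h1] at hgu
    obtain ⟨b, rfl⟩ := hgu rfl
    obtain ⟨σ, hσb, -, hσ⟩ := hg b
    rw [hσ] at hσb
    apply hz0 b
    linear_combination -hσb
  obtain ⟨σ, hσb, hσ, hσg⟩ := hg b
  let T : Subfield F := (σ : F →+* F).eqLocusField (RingHom.id F)
  have hT : ∀ f ∈ u, f ∈ T := by
    intro f hf
    obtain rfl | ⟨i, rfl⟩ := huz hf
    · exact hσg
    · exact hσ i (by rintro rfl; exact hb hf)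
  have hbT : IsAlgebraic T (z b) := by
    have h1 := hu
    rw [isTranscendenceBasis_iff_aclAdjoin_eq_top, Subtype.range_coe] at h1
    exact isAlgebraic_of_mem_aclAdjoin (h1.2.symm ▸ trivial : z b ∈ aclAdjoin k u)
      (fun a => σ.commutes a) hT
  let τ : F →ₐ[T] F := { (σ : F →+* F) with commutes' := fun a => a.2 }
  have hτ (n : ℕ) : aeval (2 ^ n * z b) (minpoly T (z b)) = 0 := by
    induction n with
    | zero => simp
    | succ n ih =>
      have h1 : τ (2 ^ n * z b) = 2 ^ (n + 1) * z b := by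
        change σ (2 ^ n * z b) = _
        rw [map_mul, map_pow, map_ofNat, hσb]; ring
      rw [← h1, aeval_algHom_apply, ih, map_zero]
  have hne : (minpoly T (z b)).map (algebraMap T F) ≠ 0 :=
    (Polynomial.map_ne_zero_iff (algebraMap T F).injective).2 (minpoly.ne_zero hbT.isIntegral)
  refine Set.infinite_of_injective_forall_mem (f := fun n : ℕ => 2 ^ n * z b)
    (s := {x | ((minpoly T (z b)).map (algebraMap T F)).IsRoot x}) (fun m n h => ?_)
    (fun n => ?_) (finite_setOfPred_isRoot hne)
  · have h1 : (2 : F) ^ m = 2 ^ n := mul_right_cancel₀ (hz0 b) h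
    exact Nat.pow_right_injective le_rfl (by exact_mod_cast h1)
  · rw [Set.mem_ofPred_eq, IsRoot, eval_map_algebraMap]
    exact hτ n

end Automorphisms

section LogBasis

variable {k₀ F I : Type*} [Field k₀] [Field F] [Algebra k₀ F]

open MvPolynomial in
open scoped IntermediateField.algebraAdjoinAdjoin in
theorem IsTranscendenceBasis.exists_kaehler_basis [CharZero F]
    {w : I → F} (hw : IsTranscendenceBasis k₀ w) :
    ∃ b : Module.Basis I F (Ω[F⁄k₀]), ∀ i, b i = KaehlerDifferential.D k₀ F (w i) := by
  have : CharZero k₀ := (RingHom.charZero_iff (algebraMap k₀ F).injective).2 inferInstance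
  let K := IntermediateField.adjoin k₀ (Set.range w)
  let A := Algebra.adjoin k₀ (Set.range w)
  algebraize [(aeval w : MvPolynomial I k₀ →ₐ[k₀] F).toRingHom]
  let _ : Algebra (MvPolynomial I k₀) A := hw.1.aevalEquiv.toRingEquiv.toRingHom.toAlgebra
  have : IsScalarTower (MvPolynomial I k₀) A F := .of_algebraMap_eq fun p =>
    (hw.1.algebraMap_aevalEquiv p).symm
  have : IsScalarTower k₀ (MvPolynomial I k₀) F := .of_algebraMap_eq fun p =>
    ((aeval w : MvPolynomial I k₀ →ₐ[k₀] F).commutes p).symm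
  have h1 : Algebra.FormallyEtale (MvPolynomial I k₀) A :=
    .of_equiv (AlgEquiv.ofRingEquiv (f := hw.1.aevalEquiv.toRingEquiv) fun p => rfl)
  have h2 : Algebra.FormallyEtale A K := .of_isLocalization (nonZeroDivisors A)
  have : Algebra.IsAlgebraic K F := hw.isAlgebraic_field
  have h3 : Algebra.FormallyEtale K F := .of_isSeparable K F
  have h4 : Algebra.FormallyEtale A F := .comp A K F
  have h5 : Algebra.FormallyEtale (MvPolynomial I k₀) F := .comp _ A F
  refine ⟨((KaehlerDifferential.mvPolynomialBasis k₀ I).baseChange F).map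
    (KaehlerDifferential.tensorKaehlerEquivOfFormallyEtale k₀ (MvPolynomial I k₀) F),
    fun i => ?_⟩
  rw [Module.Basis.map_apply, Module.Basis.baseChange_apply,
    KaehlerDifferential.mvPolynomialBasis_apply,
    KaehlerDifferential.tensorKaehlerEquivOfFormallyEtale_apply,
    KaehlerDifferential.mapBaseChange_tmul, one_smul, KaehlerDifferential.map_D]
  congr 1
  exact aeval_X w i

/-- A basis of `Ω[F⁄k₀]` formed by logarithmic differentials of a transcendence basis. -/
theorem IsTranscendenceBasis.exists_log_basis [CharZero F]
    {w : I → F} (hw : IsTranscendenceBasis k₀ w) :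
    ∃ b : Module.Basis I F (Ω[F⁄k₀]),
      ∀ i, b i = (w i)⁻¹ • KaehlerDifferential.D k₀ F (w i) := by
  obtain ⟨b, hb⟩ := hw.exists_kaehler_basis
  refine ⟨b.isUnitSMul (w := fun i => (w i)⁻¹) fun i => ?_, fun i => ?_⟩
  · exact (inv_ne_zero (hw.1.ne_zero i)).isUnit
  · rw [Module.Basis.isUnitSMul_apply, hb]

variable {b : Module.Basis I F (Ω[F⁄k₀])} {w : I → F}

/-- The coordinate of the universal derivation, as an absolute derivation. -/
noncomputable def coordDerivation (b : Module.Basis I F (Ω[F⁄k₀])) (i : I) : Derivation ℤ F F :=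
  ((b.coord i).compDer (KaehlerDifferential.D k₀ F)).restrictScalars ℤ

theorem coordDerivation_apply (b : Module.Basis I F (Ω[F⁄k₀])) (i : I) (f : F) :
    coordDerivation b i f = b.coord i (KaehlerDifferential.D k₀ F f) := rfl

theorem coordDerivation_algebraMap (b : Module.Basis I F (Ω[F⁄k₀])) (i : I) (a : k₀) :
    coordDerivation b i (algebraMap k₀ F a) = 0 := by
  simp [coordDerivation_apply]

theorem coordDerivation_self (hw : ∀ i, w i ≠ 0)
    (hb : ∀ i, b i = (w i)⁻¹ • KaehlerDifferential.D k₀ F (w i)) (i j : I) [Decidable (j = i)] :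
    coordDerivation b i (w j) = if j = i then w j else 0 := by
  have : KaehlerDifferential.D k₀ F (w j) = w j • b j := by
    rw [hb, smul_smul, mul_inv_cancel₀ (hw j), one_smul]
  rw [coordDerivation_apply, this]
  simp [Finsupp.single_apply]

theorem IsTranscendenceBasis.derivation_eq_zero [CharZero F] (hw : IsTranscendenceBasis k₀ w)
    {D : Derivation ℤ F F} (hk : ∀ a : k₀, D (algebraMap k₀ F a) = 0) (hD : ∀ i, D (w i) = 0)
    (f : F) : D f = 0 :=
  Derivation.mem_of_mem_aclAdjoin D (Set.range w) ⊥ hk (by rintro _ ⟨i, rfl⟩; exact hD i)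
    ((isTranscendenceBasis_iff_aclAdjoin_eq_top.1 hw).2.symm ▸ trivial)

/-- The conjugate of a derivation by an automorphism. -/
def Derivation.conj {F : Type*} [Field F] (D : Derivation ℤ F F) (σ : F ≃+* F) :
    Derivation ℤ F F :=
  Derivation.mk' ((σ.symm.toAddMonoidHom.comp
    ((D : F →ₗ[ℤ] F).toAddMonoidHom.comp σ.toAddMonoidHom)).toIntLinearMap) fun a b => by
      change σ.symm (D (σ (a * b))) = a * σ.symm (D (σ b)) + b * σ.symm (D (σ a))
      simp

theorem Derivation.conj_apply (D : Derivation ℤ F F) (σ : F ≃+* F) (f : F) :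
    D.conj σ f = σ.symm (D (σ f)) := rfl

theorem coordDerivation_algEquiv [CharZero F] (hw : IsTranscendenceBasis k₀ w)
    (σ : F ≃ₐ[k₀] F) (i : I) (m : F)
    (h : ∀ j, coordDerivation b i (σ (w j)) = m * σ (coordDerivation b i (w j))) (f : F) :
    coordDerivation b i (σ f) = m * σ (coordDerivation b i f) := by
  have := hw.derivation_eq_zero
    (D := (coordDerivation b i).conj σ.toRingEquiv - σ.symm m • coordDerivation b i)
    (fun a => ?_) (fun j => ?_) f
  · rw [Derivation.sub_apply, Derivation.smul_apply, sub_eq_zero, Derivation.conj_apply] at this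
    have := congrArg σ this
    simpa using this
  · have : σ.toRingEquiv (algebraMap k₀ F a) = algebraMap k₀ F a := σ.commutes a
    rw [Derivation.sub_apply, Derivation.smul_apply, Derivation.conj_apply, this,
      coordDerivation_algebraMap]
    simp
  · rw [Derivation.sub_apply, Derivation.smul_apply, Derivation.conj_apply]
    have : coordDerivation b i (σ.toRingEquiv (w j)) = _ := h j
    rw [this]
    change σ.symm _ - _ = _
    simp

end LogBasis

section Coordinates

variable {R M I : Type*} [CommRing R] [AddCommGroup M] [Module R M] {n : ℕ}

/-- The coordinate of an `n`-form along the basis covectors `b.coord (a j)`. -/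
noncomputable def wedgeCoord (b : Module.Basis I R M) (a : Fin n → I) :
    Module.Dual R (⋀[R]^n M) :=
  exteriorPower.pairingDual R M n (exteriorPower.ιMulti R n fun j => b.coord (a j))

theorem wedgeCoord_ιMulti (b : Module.Basis I R M) (a : Fin n → I) (v : Fin n → M) :
    wedgeCoord b a (exteriorPower.ιMulti R n v) =
      (Matrix.of fun i j => b.coord (a j) (v i)).det := by
  rw [wedgeCoord, exteriorPower.pairingDual_ιMulti_ιMulti]

theorem eq_zero_of_wedgeCoord_eq_zero (b : Module.Basis I R M) {η : ⋀[R]^n M}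
    (h : ∀ a : Fin n → I, Function.Injective a → wedgeCoord b a η = 0) : η = 0 := by
  classical
  let : LinearOrder I := linearOrderOfSTO WellOrderingRel
  refine (b.exteriorPower n).ext_elem fun s => ?_
  rw [map_zero, Finsupp.zero_apply, exteriorPower.basis_repr_apply]
  exact h _ (Set.powersetCard.ofFinEmbEquiv.symm s).injective

theorem wedgeCoord_comp_perm (b : Module.Basis I R M) (a : Fin n → I) (π : Equiv.Perm (Fin n))
    (η : ⋀[R]^n M) : wedgeCoord b (a ∘ π) η = Equiv.Perm.sign π • wedgeCoord b a η := by
  have := (exteriorPower.ιMulti R n (M := Module.Dual R M)).map_perm (fun j => b.coord (a j)) π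
  rw [wedgeCoord]
  erw [this]
  simp [wedgeCoord, Units.smul_def]

end Coordinates

section LogForms

variable {k₀ F I : Type*} [Field k₀] [Field F] [Algebra k₀ F] {q : ℕ}

/-- Every `q`-form is a sum of forms `f₀ df₁ ∧ … ∧ df_q`. -/
theorem exteriorPower_kaehler_induction {p : ⋀[F]^q (Ω[F⁄k₀]) → Prop} (zero : p 0)
    (add : ∀ η η', p η → p η' → p (η + η'))
    (smul_wedge : ∀ (f₀ : F) (f : Fin q → F),
      p (f₀ • wedge F (Ω[F⁄k₀]) q fun i => KaehlerDifferential.D k₀ F (f i)))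
    (η : ⋀[F]^q (Ω[F⁄k₀])) : p η := by
  have h := exteriorPower.ιMulti_span_of_span F q (Ω[F⁄k₀])
    (KaehlerDifferential.span_range_derivation k₀ F)
  suffices ∀ c : F, p (c • η) by simpa using this 1
  induction (h.symm ▸ Submodule.mem_top : η ∈ Submodule.span F _) using
    Submodule.span_induction with
  | mem η hη =>
    obtain ⟨a, ha, rfl⟩ := hη
    choose f hf using fun i => ha (Set.mem_range_self i)
    obtain rfl := funext hf
    exact fun c => smul_wedge c f
  | zero => simpa using zero
  | add η η' _ _ h h' => exact fun c => by rw [smul_add]; exact add _ _ (h c) (h' c)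
  | smul a η _ h => exact fun c => by rw [smul_smul]; exact h _

variable (k₀) in
/-- The logarithmic form `(df₁/f₁) ∧ … ∧ (df_q/f_q)`. -/
noncomputable def dlogWedge (f : Fin q → F) : ⋀[F]^q (Ω[F⁄k₀]) :=
  wedge F (Ω[F⁄k₀]) q fun i => (f i)⁻¹ • KaehlerDifferential.D k₀ F (f i)

theorem dlogWedge_eq_smul (f : Fin q → F) :
    dlogWedge k₀ f =
      (∏ i, (f i)⁻¹) • wedge F (Ω[F⁄k₀]) q fun i => KaehlerDifferential.D k₀ F (f i) :=
  (exteriorPower.ιMulti F q (M := Ω[F⁄k₀])).map_smul_univ _ _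

theorem smul_dlogWedge_mem_logForms (c : ℚ) {f : Fin q → F} (hf : ∀ i, f i ≠ 0) :
    (c : F) • dlogWedge k₀ f ∈ logForms k₀ F q :=
  AddSubgroup.subset_closure ⟨c, f, hf, rfl⟩

theorem wedgeCoord_dlogWedge (b : Module.Basis I F (Ω[F⁄k₀])) (a : Fin q → I) (f : Fin q → F) :
    wedgeCoord b a (dlogWedge k₀ f) =
      (Matrix.of fun i j => coordDerivation b (a j) (f i) / f i).det := by
  refine (wedgeCoord_ιMulti b a _).trans ?_
  congr 2
  ext i j
  rw [map_smul, coordDerivation_apply, smul_eq_mul, div_eq_inv_mul]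

section Action

variable {σ : F ≃ₐ[k₀] F} {T : ⋀[F]^q (Ω[F⁄k₀]) →+ ⋀[F]^q (Ω[F⁄k₀])}

theorem map_smul_dlogWedge
    (hT : ∀ (f₀ : F) (f : Fin q → F),
      T (f₀ • wedge F (Ω[F⁄k₀]) q fun i => KaehlerDifferential.D k₀ F (f i)) =
        σ f₀ • wedge F (Ω[F⁄k₀]) q fun i => KaehlerDifferential.D k₀ F (σ (f i)))
    (c : F) (f : Fin q → F) :
    T (c • dlogWedge k₀ f) = σ c • dlogWedge k₀ (σ ∘ f) := by
  rw [dlogWedge_eq_smul, smul_smul, hT, dlogWedge_eq_smul, smul_smul]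
  simp

theorem map_mem_logForms
    (hT : ∀ (f₀ : F) (f : Fin q → F),
      T (f₀ • wedge F (Ω[F⁄k₀]) q fun i => KaehlerDifferential.D k₀ F (f i)) =
        σ f₀ • wedge F (Ω[F⁄k₀]) q fun i => KaehlerDifferential.D k₀ F (σ (f i)))
    {ω : ⋀[F]^q (Ω[F⁄k₀])} (hω : ω ∈ logForms k₀ F q) :
    T ω ∈ logForms k₀ F q := by
  suffices logForms k₀ F q ≤ (logForms k₀ F q).comap T from this hω
  refine (AddSubgroup.closure_le _).2 ?_
  rintro _ ⟨c, f, hf, rfl⟩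
  have := map_smul_dlogWedge hT c f
  rw [map_ratCast] at this
  change T ((c : F) • dlogWedge k₀ f) ∈ logForms k₀ F q
  rw [this]
  exact smul_dlogWedge_mem_logForms c (f := σ ∘ f) (by simpa using hf)

theorem wedgeCoord_map
    (hT : ∀ (f₀ : F) (f : Fin q → F),
      T (f₀ • wedge F (Ω[F⁄k₀]) q fun i => KaehlerDifferential.D k₀ F (f i)) =
        σ f₀ • wedge F (Ω[F⁄k₀]) q fun i => KaehlerDifferential.D k₀ F (σ (f i)))
    {b : Module.Basis I F (Ω[F⁄k₀])} {m : I → F}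
    (hm : ∀ i f, coordDerivation b i (σ f) = m i * σ (coordDerivation b i f))
    (a : Fin q → I) (η : ⋀[F]^q (Ω[F⁄k₀])) :
    wedgeCoord b a (T η) = (∏ j, m (a j)) * σ (wedgeCoord b a η) := by
  induction η using exteriorPower_kaehler_induction with
  | zero => simp
  | add η η' h h' => simp only [map_add, h, h', mul_add]
  | smul_wedge f₀ f =>
    have h (f : Fin q → F) : wedgeCoord b a (wedge F (Ω[F⁄k₀]) q fun i =>
        KaehlerDifferential.D k₀ F (f i)) =
        (Matrix.of fun i j => coordDerivation b (a j) (f i)).det := wedgeCoord_ιMulti b a _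
    rw [hT, map_smul, map_smul, h, h, smul_eq_mul, smul_eq_mul, map_mul]
    have h1 := Matrix.det_mul_row (fun j => m (a j))
      (Matrix.of fun i j => σ (coordDerivation b (a j) (f i)))
    simp only [Matrix.of_apply] at h1
    simp only [hm, h1]
    have h2 : σ (Matrix.of fun i j => coordDerivation b (a j) (f i)).det = _ :=
      AlgEquiv.map_det σ _
    rw [h2]
    have h3 : σ.toAlgHom.mapMatrix (Matrix.of fun i j => coordDerivation b (a j) (f i)) =
      Matrix.of fun i j => σ (coordDerivation b (a j) (f i)) := rfl
    erw [h3]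
    ring

end Action

theorem exists_finite_of_mem_logForms {ω : ⋀[F]^q (Ω[F⁄k₀])} (hω : ω ∈ logForms k₀ F q) :
    ∃ S : Set F, S.Finite ∧ (∀ f ∈ S, f ≠ 0) ∧
      ω ∈ AddSubgroup.closure {η | ∃ (c : ℚ) (f : Fin q → F), (∀ i, f i ∈ S) ∧
        η = (c : F) • dlogWedge k₀ f} := by
  have hmono {S S' : Set F} (h : S ⊆ S') :
      AddSubgroup.closure {η | ∃ (c : ℚ) (f : Fin q → F), (∀ i, f i ∈ S) ∧
        η = (c : F) • dlogWedge k₀ f} ≤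
      AddSubgroup.closure {η | ∃ (c : ℚ) (f : Fin q → F), (∀ i, f i ∈ S') ∧
        η = (c : F) • dlogWedge k₀ f} :=
    AddSubgroup.closure_mono fun η ⟨c, f, hf, hη⟩ => ⟨c, f, fun i => h (hf i), hη⟩
  induction hω using AddSubgroup.closure_induction with
  | mem ω hω =>
    obtain ⟨c, f, hf, rfl⟩ := hω
    exact ⟨Set.range f, Set.finite_range f, by simpa using hf,
      AddSubgroup.subset_closure ⟨c, f, fun i => Set.mem_range_self i, rfl⟩⟩
  | zero => exact ⟨∅, Set.finite_empty, by simp, zero_mem _⟩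
  | add ω ω' _ _ h h' =>
    obtain ⟨S, hS, hS0, h⟩ := h
    obtain ⟨S', hS', hS0', h'⟩ := h'
    refine ⟨S ∪ S', hS.union hS', ?_, add_mem (hmono Set.subset_union_left h)
      (hmono Set.subset_union_right h')⟩
    rintro f (hf | hf)
    exacts [hS0 f hf, hS0' f hf]
  | neg ω _ h =>
    obtain ⟨S, hS, hS0, h⟩ := h
    exact ⟨S, hS, hS0, neg_mem h⟩

theorem exists_ratCast_of_det [CharZero F] {O : Subring F} (r : O →+* F)
    {A : Matrix (Fin q) (Fin q) F} (c : ℚ) (hQ : ∀ c : ℚ, (c : F) ∈ O)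
    (hA : ∀ i j, ∃ (h : A i j ∈ O) (c : ℚ), r ⟨_, h⟩ = c) :
    ∃ (h : (c : F) * A.det ∈ O) (c' : ℚ), r ⟨_, h⟩ = c' := by
  choose h C hC using hA
  let A' : Matrix (Fin q) (Fin q) O := Matrix.of fun i j => ⟨A i j, h i j⟩
  have hA' : ((A'.det : O) : F) = A.det := O.subtype.map_det A'
  have hr : r A'.det = ((Matrix.of C).det : ℚ) := by
    rw [r.map_det, ← eq_ratCast (algebraMap ℚ F), RingHom.map_det]
    congr 1
    ext i j
    exact (hC i j).trans (eq_ratCast (algebraMap ℚ F) _).symm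
  have hc : r ⟨c, hQ c⟩ = c := by
    let f : ℚ →+* O := (algebraMap ℚ F).codRestrict O fun c => by simpa using hQ c
    have h1 : (⟨c, hQ c⟩ : O) = f c := Subtype.ext (eq_ratCast (algebraMap ℚ F) c).symm
    rw [h1]
    exact eq_ratCast (r.comp f) c
  refine ⟨hA' ▸ mul_mem (hQ c) A'.det.2, c * (Matrix.of C).det, ?_⟩
  have : (⟨(c : F) * A.det, hA' ▸ mul_mem (hQ c) A'.det.2⟩ : O) = ⟨c, hQ c⟩ * A'.det :=
    Subtype.ext (by simp [hA'])
  rw [this, map_mul, hc, hr]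
  push_cast
  rfl

end LogForms

section Endomorphism

variable {k₀ k F κ T : Type*} [Field k₀] [Field k] [Field F]
  [Algebra k₀ F] [Algebra k F] {q : ℕ}

theorem exists_ratCast_wedgeCoord [CharZero F] {I : Type*} [IsAlgClosed F] {z : Fin q ⊕ κ → F}
    (hz : IsTranscendenceBasis k z) {b : Module.Basis I F (Ω[F⁄k₀])} {a : Fin q → I}
    (hk : ∀ (j : Fin q) (c : k), coordDerivation b (a j) (algebraMap k F c) = 0)
    (hinr : ∀ (j : Fin q) (i : κ), coordDerivation b (a j) (z (.inr i)) = 0)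
    (hmul : ∀ (j : Fin q) (i : Fin q ⊕ κ), ∃ c : ℚ, coordDerivation b (a j) (z i) = c * z i)
    {ω : ⋀[F]^q (Ω[F⁄k₀])} (hω : ω ∈ logForms k₀ F q)
    (h : wedgeCoord b a ω ∈ (algebraMap k F).range) : ∃ c : ℚ, wedgeCoord b a ω = c := by
  obtain ⟨S, hS, hS0, hωS⟩ := exists_finite_of_mem_logForms hω
  obtain ⟨O, r, hr, H⟩ := exists_rational_place hz.1 (Set.range Sum.inr)
    (Finset.univ.map Function.Embedding.inl) (by
      rw [Set.disjoint_left]; rintro _ ⟨i, rfl⟩; simp) hS (by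
      have : Set.range (Sum.inr : κ → Fin q ⊕ κ) ∪
          (Finset.univ.map (Function.Embedding.inl : Fin q ↪ Fin q ⊕ κ) : Finset _) = Set.univ := by
        ext i; cases i <;> simp
      rw [this, Set.image_univ, (isTranscendenceBasis_iff_aclAdjoin_eq_top.1 hz).2]
      exact fun _ _ => trivial) hS0
  have hk' (c : k) : ∃ h : algebraMap k F c ∈ O, r ⟨_, h⟩ = algebraMap k F c :=
    hr _ (algebraMap_mem_aclAdjoin _ c)
  have hQ (c : ℚ) : (c : F) ∈ O := (hr c (SubfieldClass.ratCast_mem _ c)).1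
  have key : ∃ y : O, (y : F) = wedgeCoord b a ω ∧ ∃ c : ℚ, r y = c := by
    clear h hω
    induction hωS using AddSubgroup.closure_induction with
    | mem ω hω =>
      obtain ⟨c, f, hf, rfl⟩ := hω
      simp only [map_smul, wedgeCoord_dlogWedge, smul_eq_mul]
      obtain ⟨h, hc⟩ := exists_ratCast_of_det r c hQ fun i j => H (f i) (hf i) _ (hk j)
        (by rintro _ ⟨i, rfl⟩; exact hinr j i) (hmul j)
      exact ⟨_, rfl, hc⟩
    | zero => exact ⟨0, by simp, 0, by simp⟩
    | add ω ω' _ _ h h' =>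
      obtain ⟨y, hy, c, hc⟩ := h
      obtain ⟨y', hy', c', hc'⟩ := h'
      exact ⟨y + y', by simp [hy, hy'], c + c', by simp [hc, hc']⟩
    | neg ω _ h =>
      obtain ⟨y, hy, c, hc⟩ := h
      exact ⟨-y, by simp [hy], -c, by simp [hc]⟩
  obtain ⟨g, hg⟩ := h
  obtain ⟨y, hy, c, hc⟩ := key
  obtain ⟨h', hg'⟩ := hk' g
  refine ⟨c, ?_⟩
  rw [← hc, ← hg, ← hg']
  exact congrArg r (Subtype.ext (hg.trans hy.symm))

theorem IsTranscendenceBasis.algebraMap_mem_aclAdjoin_image [Algebra k₀ k] [IsScalarTower k₀ k F]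
    {t : T → k}
    (ht : IsTranscendenceBasis k₀ t) (c : k) :
    algebraMap k F c ∈ aclAdjoin k₀ (algebraMap k F '' Set.range t) := by
  let E := aclAdjoin k₀ (algebraMap k F '' Set.range t)
  have h := isAlgebraic_of_mem_aclAdjoin (T := E.comap (algebraMap k F)) (f := c) (S := Set.range t)
    (by rw [(isTranscendenceBasis_iff_aclAdjoin_eq_top.1 ht).2]; trivial)
    (fun a => ?_) (fun f hf => subset_aclAdjoin _ ⟨f, hf, rfl⟩)
  · refine mem_aclAdjoin_of_isAlgebraic (h.ringHom_of_comp_eq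
      ((algebraMap k F).restrict (E.comap (algebraMap k F)) E fun _ h => h) (algebraMap k F)
      (RingHom.injective _) rfl)
  · change algebraMap k F (algebraMap k₀ k a) ∈ E
    rw [← IsScalarTower.algebraMap_apply]
    exact algebraMap_mem_aclAdjoin _ a

theorem coordDerivation_algEquiv_of_eq_mul_pow [Algebra k₀ k] [IsScalarTower k₀ k F] [CharZero F]
    {ι T : Type*} {z : ι → F} {t : T → k}
    (hw : IsTranscendenceBasis k₀ (Sum.elim z (algebraMap k F ∘ t)))
    {b : Module.Basis (ι ⊕ T) F (Ω[F⁄k₀])}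
    (hb : ∀ i, b i = (Sum.elim z (algebraMap k F ∘ t) i)⁻¹ •
      KaehlerDifferential.D k₀ F (Sum.elim z (algebraMap k F ∘ t) i))
    {σ : F ≃ₐ[k] F} {i₀ : ι} {l m : ℕ} (hσ₀ : σ (z i₀) = l * z i₀ ^ m)
    (hσ : ∀ i ≠ i₀, σ (z i) = z i) (i : ι ⊕ T) [Decidable (i = .inl i₀)] (f : F) :
    coordDerivation b i (σ f) =
      ((if i = .inl i₀ then m else 1 : ℕ) : F) * σ (coordDerivation b i f) := by
  classical
  set w := Sum.elim z (algebraMap k F ∘ t) with hwdef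
  have hself := coordDerivation_self hw.1.ne_zero hb
  refine coordDerivation_algEquiv hw (σ.restrictScalars k₀) i _ (fun j => ?_) f
  change coordDerivation b i (σ (w j)) = _ * σ (coordDerivation b i (w j))
  have hfix (hj : j ≠ .inl i₀) : σ (w j) = w j := by
    rcases j with j | j
    · exact hσ j (by simpa using hj)
    · exact σ.commutes _
  by_cases hj : j = .inl i₀
  · have h1 : w j = z i₀ := by rw [hj]; rfl
    have h2 := hself i j
    rw [h1] at h2 ⊢
    rw [hσ₀, Derivation.leibniz, Derivation.leibniz_pow, Derivation.map_natCast, h2]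
    subst hj
    rcases eq_or_ne i (.inl i₀) with rfl | hi
    · simp only [if_true, smul_eq_mul, nsmul_eq_mul]
      rw [hσ₀]
      rcases m with _ | m
      · simp
      · simp; ring
    · simp [hi.symm]
  · rw [hfix hj, hself]
    rcases eq_or_ne j i with rfl | hi
    · simp [hj, hfix hj]
    · simp [hi]

theorem exists_eq_smul_dlogWedge [Algebra k₀ k] [IsScalarTower k₀ k F] [CharZero F]
    [IsAlgClosed k] [IsAlgClosed F] {z : Fin q ⊕ κ → F}
    (hz : IsTranscendenceBasis k z)
    {ρ : (F ≃ₐ[k] F) → (⋀[F]^q (Ω[F⁄k₀]) →+ ⋀[F]^q (Ω[F⁄k₀]))}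
    (hρ : ∀ (σ : F ≃ₐ[k] F) (f₀ : F) (f : Fin q → F),
      ρ σ (f₀ • wedge F (Ω[F⁄k₀]) q (fun i => KaehlerDifferential.D k₀ F (f i))) =
        σ f₀ • wedge F (Ω[F⁄k₀]) q (fun i => KaehlerDifferential.D k₀ F (σ (f i))))
    {η : ⋀[F]^q (Ω[F⁄k₀])} (hη : η ∈ logForms k₀ F q)
    (hinv : ∀ (σ : F ≃ₐ[k] F) (n : ℕ),
      ρ σ (dlogWedge k₀ (z ∘ Sum.inl)) = (n : F) • dlogWedge k₀ (z ∘ Sum.inl) →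
        ρ σ η = (n : F) • η) :
    ∃ c : ℚ, η = (c : F) • dlogWedge k₀ (z ∘ Sum.inl) := by
  classical
  obtain ⟨T, t, ht⟩ := exists_isTranscendenceBasis' k₀ k
  have hw := ht.sumElim_comp hz
  obtain ⟨b, hb⟩ := hw.exists_log_basis
  have hself := coordDerivation_self hw.1.ne_zero hb
  have hcoord {σ : F ≃ₐ[k] F} {i₀ : Fin q ⊕ κ} {l m : ℕ} (hσ₀ : σ (z i₀) = l * z i₀ ^ m)
      (hσ : ∀ i ≠ i₀, σ (z i) = z i) (a : Fin q → (Fin q ⊕ κ) ⊕ T) (η : ⋀[F]^q (Ω[F⁄k₀])) :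
      wedgeCoord b a (ρ σ η) =
        (∏ j, ((if a j = .inl i₀ then m else 1 : ℕ) : F)) * σ (wedgeCoord b a η) :=
    wedgeCoord_map (σ := σ.restrictScalars k₀) (T := ρ σ) (hρ σ)
      (m := fun i => ((if i = .inl i₀ then m else 1 : ℕ) : F))
      (fun i f => coordDerivation_algEquiv_of_eq_mul_pow hw hb hσ₀ hσ i f) a η
  have hx (a : Fin q → (Fin q ⊕ κ) ⊕ T) : wedgeCoord b a (dlogWedge k₀ (z ∘ Sum.inl)) =
      ((Matrix.of fun i j => if a j = .inl (.inl i) then 1 else 0 : Matrix (Fin q) (Fin q) ℚ).det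
        : ℚ) := by
    rw [wedgeCoord_dlogWedge, ← eq_ratCast (algebraMap ℚ F), RingHom.map_det]
    congr 1
    ext i j
    have h1 := hself (a j) (.inl (.inl i))
    simp only [Sum.elim_inl] at h1
    have h2 := hz.1.ne_zero (.inl i)
    simp only [Matrix.of_apply, Function.comp_apply, h1, RingHom.mapMatrix_apply, Matrix.map_apply]
    by_cases h3 : a j = .inl (.inl i)
    · simp [h3, h2]
    · simp [h3, Ne.symm h3]
  have hρx {σ : F ≃ₐ[k] F} {i₀ : Fin q ⊕ κ} {l m : ℕ} (hσ₀ : σ (z i₀) = l * z i₀ ^ m)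
      (hσ : ∀ i ≠ i₀, σ (z i) = z i) {n : ℕ}
      (hn : ∀ a : Fin q → (Fin q ⊕ κ) ⊕ T, Function.Injective a →
        wedgeCoord b a (dlogWedge k₀ (z ∘ Sum.inl)) ≠ 0 →
        ∏ j, (if a j = .inl i₀ then m else 1) = n) :
      ρ σ η = (n : F) • η := by
    refine hinv σ n (sub_eq_zero.1 (eq_zero_of_wedgeCoord_eq_zero b fun a ha => ?_))
    rw [map_sub, hcoord hσ₀ hσ, map_smul, hx, map_ratCast, ← hx, smul_eq_mul, ← sub_mul]
    by_cases h0 : wedgeCoord b a (dlogWedge k₀ (z ∘ Sum.inl)) = 0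
    · rw [h0, mul_zero]
    · rw [← hn a ha h0]; simp
  have hconst (a : Fin q → (Fin q ⊕ κ) ⊕ T) : wedgeCoord b a η ∈ (algebraMap k F).range := by
    refine hz.mem_range_algebraMap fun i₀ => ?_
    obtain ⟨σ, hσ₀, hσ⟩ := hz.exists_algEquiv_two_mul i₀
    refine ⟨σ, hσ₀, hσ, ?_⟩
    have hσ₀' : σ (z i₀) = (2 : ℕ) * z i₀ ^ 1 := by simpa using hσ₀
    have h1 := hρx hσ₀' hσ (n := 1) (by simp)
    have h2 := hcoord hσ₀' hσ a η
    rw [h1] at h2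
    simpa using h2.symm
  have hzero (a : Fin q → (Fin q ⊕ κ) ⊕ T) (i : Fin q) (hi : ∀ j, a j ≠ .inl (.inl i)) :
      wedgeCoord b a η = 0 := by
    obtain ⟨σ, hσ₀, hσ⟩ := hz.exists_algEquiv_sq (.inl i)
    have hσ₀' : σ (z (.inl i)) = (1 : ℕ) * z (.inl i) ^ 2 := by simpa using hσ₀
    have h1 := hρx hσ₀' hσ (n := 2) fun a ha h0 => by
      obtain ⟨j, hj⟩ : ∃ j, a j = .inl (.inl i) := by
        by_contra! hc
        rw [hx] at h0
        exact h0 (by rw [Matrix.det_eq_zero_of_row_eq_zero i (by simp [hc]), Rat.cast_zero])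
      rw [Finset.prod_eq_single j (fun j' _ hj' => if_neg fun h => hj' (ha (h.trans hj.symm)))
        (by simp), if_pos hj]
    have h2 := hcoord hσ₀' hσ a η
    obtain ⟨g, hg⟩ := hconst a
    rw [h1, map_smul, ← hg, σ.commutes] at h2
    simp only [hi, if_false, Nat.cast_one, Finset.prod_const_one, one_mul, smul_eq_mul] at h2
    rw [← hg]
    push_cast at h2
    linear_combination h2
  have hkill (i : Fin q ⊕ κ) (c : k) : coordDerivation b (.inl i) (algebraMap k F c) = 0 := by
    refine (coordDerivation b (.inl i)).mem_of_mem_aclAdjoin _ ⊥ (coordDerivation_algebraMap b _)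
      ?_ (ht.algebraMap_mem_aclAdjoin_image c)
    rintro _ ⟨_, ⟨j, rfl⟩, rfl⟩
    simpa using hself (.inl i) (.inr j)
  obtain ⟨c, hc⟩ := exists_ratCast_wedgeCoord hz (b := b) (a := fun j => .inl (.inl j))
    (fun j => hkill _) (fun j i => by simpa using hself (.inl (.inl j)) (.inl (.inr i)))
    (fun j i => by
      have h1 := hself (.inl (.inl j)) (.inl i)
      simp only [Sum.elim_inl] at h1
      rw [h1]
      split_ifs
      · exact ⟨1, by simp⟩
      · exact ⟨0, by simp⟩) hη (hconst _)
  refine ⟨c, sub_eq_zero.1 (eq_zero_of_wedgeCoord_eq_zero b fun a ha => ?_)⟩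
  by_cases h : ∃ i : Fin q, ∀ j, a j ≠ .inl (.inl i)
  · obtain ⟨i, hi⟩ := h
    rw [map_sub, map_smul, hzero a i hi, hx,
      Matrix.det_eq_zero_of_row_eq_zero i (by simp [hi])]
    simp
  · push Not at h
    choose π hπ using h
    have hπi : Function.Injective π := fun i i' h => by
      have := (hπ i).symm.trans ((congrArg a h).trans (hπ i'))
      simpa using this
    let e := Equiv.ofBijective π (Finite.injective_iff_bijective.1 hπi)
    obtain rfl : a = (fun j => .inl (.inl j)) ∘ e.symm := by
      ext1 j
      obtain ⟨i, rfl⟩ := e.surjective j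
      simpa using! hπ i
    rw [wedgeCoord_comp_perm, map_sub, hc, map_smul, hx]
    have : (Matrix.of fun i j => if (.inl (.inl j) : (Fin q ⊕ κ) ⊕ T) = .inl (.inl i)
        then 1 else 0 : Matrix (Fin q) (Fin q) ℚ) = 1 := by
      ext i j
      simp [Matrix.one_apply, eq_comm]
    rw [this]
    simp

end Endomorphism

section Generation

variable {k F κ : Type*} [Field k] [Field F] [Algebra k F] {q : ℕ}

theorem IsTranscendenceBasis.exists_algEquiv_of_algebraicIndependent [IsAlgClosed F]
    {z : Fin q ⊕ κ → F} (hz : IsTranscendenceBasis k z) {f : Fin q → F}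
    (hf : AlgebraicIndependent k f) : ∃ σ : F ≃ₐ[k] F, ∀ i, σ (z (.inl i)) = f i := by
  classical
  obtain ⟨t, hft, ht⟩ := exists_isTranscendenceBasis_superset hf.to_subtype_range
  let e : Fin q ⊕ ↥(t \ Set.range f) ≃ t :=
    ((Equiv.ofInjective f hf.injective).sumCongr (Equiv.refl _)).trans (Equiv.Set.sumDiffSubset hft)
  have hcard := hz.lift_cardinalMk_eq ((isTranscendenceBasis_equiv e).2 ht)
  simp only [Cardinal.mk_sum, Cardinal.lift_add, Cardinal.lift_lift, Cardinal.mk_fin,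
    Cardinal.lift_natCast] at hcard
  obtain ⟨e'⟩ := Cardinal.lift_mk_eq'.1
    (Cardinal.eq_of_add_eq_add_left hcard (Cardinal.natCast_lt_aleph0))
  obtain ⟨σ, hσ⟩ := hz.exists_algEquiv
    ((isTranscendenceBasis_equiv (((Equiv.refl _).sumCongr e').trans e)).2 ht)
  refine ⟨σ, fun i => ?_⟩
  rw [hσ]
  simp [e]

theorem AlgebraicIndepOn.insert_of_notMem_aclAdjoin {ι : Type*} {f : ι → F} {s : Set ι} {i : ι}
    (hs : AlgebraicIndepOn k f s) (hi : f i ∉ aclAdjoin k (f '' s)) :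
    AlgebraicIndepOn k f (insert i s) := by
  rw [mem_aclAdjoin, IntermediateField.isAlgebraic_adjoin_iff] at hi
  exact hs.insert hi

theorem IsTranscendenceBasis.exists_notMem_aclAdjoin {z : Fin q ⊕ κ → F}
    (hz : IsTranscendenceBasis k z) {f : Fin q → F} {m : ℕ} (hm : m < q)
    (hf : AlgebraicIndepOn k f {i | (i : ℕ) < m}) :
    ∃ g, g ∉ aclAdjoin k (f '' {i | (i : ℕ) < m}) := by
  by_contra! hc
  have h : IsTranscendenceBasis k fun i : {i : Fin q | (i : ℕ) < m} => f i := by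
    rw [isTranscendenceBasis_iff_aclAdjoin_eq_top, eq_top_iff]
    refine ⟨hf, fun g _ => ?_⟩
    rw [← Set.image_eq_range]
    exact hc g
  have hcard := Cardinal.lift_mk_eq'.1 (hz.lift_cardinalMk_eq h)
  obtain ⟨e⟩ := hcard
  have : Finite (Fin q ⊕ κ) := .of_equiv _ e.symm
  let g : Fin q → Fin m := fun i => ⟨(e (.inl i)).1, (e (.inl i)).2⟩
  have hg : Function.Injective g := fun i j h => by
    have h1 : e (.inl i) = e (.inl j) := Subtype.ext (Fin.ext (by simpa [g] using h))
    simpa using h1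
  have := Fintype.card_le_of_injective g hg
  simp at this
  omega

variable {k₀ : Type*} [Field k₀] [Algebra k₀ F]

theorem dlogWedge_update_mul (f : Fin q → F) (i : Fin q) {a b : F} (ha : a ≠ 0) (hb : b ≠ 0) :
    dlogWedge k₀ (Function.update f i (a * b)) =
      dlogWedge k₀ (Function.update f i a) + dlogWedge k₀ (Function.update f i b) := by
  have h (c : F) : dlogWedge k₀ (Function.update f i c) =
      exteriorPower.ιMulti F q (Function.update
        (fun j => (f j)⁻¹ • KaehlerDifferential.D k₀ F (f j)) i
        (c⁻¹ • KaehlerDifferential.D k₀ F c)) := by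
    refine congrArg (exteriorPower.ιMulti F q) (funext fun j => ?_)
    rcases eq_or_ne j i with rfl | hj
    · simp
    · simp [hj]
  rw [h, h, h, ← AlternatingMap.map_update_add]
  congr 2
  rw [Derivation.leibniz, smul_add, smul_smul, smul_smul, add_comm]
  congr 2 <;> field_simp

theorem smul_dlogWedge_mem_of_algebraicIndependent [CharZero F] {z : Fin q ⊕ κ → F}
    (hz : IsTranscendenceBasis k z) {H : AddSubgroup (⋀[F]^q (Ω[F⁄k₀]))} {c : F}
    (hH : ∀ f : Fin q → F, AlgebraicIndependent k f → c • dlogWedge k₀ f ∈ H)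
    {f : Fin q → F} (hf : ∀ i, f i ≠ 0) : c • dlogWedge k₀ f ∈ H := by
  suffices ∀ (l m : ℕ), l + m = q → ∀ f : Fin q → F, (∀ i, f i ≠ 0) →
      AlgebraicIndepOn k f {i | (i : ℕ) < m} → c • dlogWedge k₀ f ∈ H by
    refine this q 0 rfl f hf ?_
    have : IsEmpty {i : Fin q | (i : ℕ) < 0} := by simp
    exact (algebraicIndependent_empty_type_iff (R := k)).2 (algebraMap k F).injective
  intro l
  induction l with
  | zero =>
    rintro m rfl f - h
    refine hH f ?_
    have : {i : Fin (0 + m) | (i : ℕ) < m} = Set.univ := by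
      ext i; have := i.2; simp; omega
    rw [this] at h
    exact h.comp (fun i => ⟨i, trivial⟩) fun i j h => congrArg Subtype.val h
  | succ l ih =>
    intro m hlm f hf h
    have hm : m < q := by omega
    have hstep (f' : Fin q → F) (hf' : ∀ i, f' i ≠ 0) (hff' : ∀ i : Fin q, i < m → f' i = f i)
        (hi : f' ⟨m, hm⟩ ∉ aclAdjoin k (f '' {i | (i : ℕ) < m})) :
        c • dlogWedge k₀ f' ∈ H := by
      refine ih (m + 1) (by omega) f' hf' ?_
      have hs : {i : Fin q | (i : ℕ) < m + 1} = insert ⟨m, hm⟩ {i : Fin q | (i : ℕ) < m} := by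
        ext i; simp [Fin.ext_iff]; omega
      rw [hs]
      refine AlgebraicIndepOn.insert_of_notMem_aclAdjoin ?_ ?_
      · have hs' : (fun i : {i : Fin q | (i : ℕ) < m} => f' i) = fun i => f i.1 :=
          funext fun i => hff' i.1 i.2
        rw [AlgebraicIndepOn, hs']
        exact h
      · have hs' : f' '' {i | (i : ℕ) < m} = f '' {i | (i : ℕ) < m} := Set.image_congr hff'
        rwa [hs']
    by_cases hfm : f ⟨m, hm⟩ ∈ aclAdjoin k (f '' {i | (i : ℕ) < m})
    · obtain ⟨g, hg⟩ := hz.exists_notMem_aclAdjoin hm h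
      have hg0 : g ≠ 0 := by rintro rfl; exact hg (zero_mem _)
      have hne (g : F) (hg : g ≠ 0) (i : Fin q) : Function.update f ⟨m, hm⟩ g i ≠ 0 := by
        rcases eq_or_ne i ⟨m, hm⟩ with rfl | hi
        · simpa
        · simpa [hi] using hf i
      have hlt (g : F) (i : Fin q) (hi : i < m) : Function.update f ⟨m, hm⟩ g i = f i :=
        Function.update_of_ne (by rintro rfl; simp at hi) _ _
      have hdiv : f ⟨m, hm⟩ / g ≠ 0 := div_ne_zero (hf _) hg0
      have h1 := dlogWedge_update_mul (k₀ := k₀) f ⟨m, hm⟩ hg0 hdiv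
      rw [mul_div_cancel₀ _ hg0, Function.update_eq_self] at h1
      rw [h1, smul_add]
      refine add_mem (hstep _ (hne g hg0) (hlt g) (by simpa))
        (hstep _ (hne _ hdiv) (hlt _) ?_)
      rw [Function.update_self]
      intro h2
      refine hg ?_
      have h3 := div_mem hfm h2
      rwa [div_div_cancel₀ (hf _)] at h3
    · exact hstep f hf (fun _ _ => rfl) hfm

end Generation

theorem exists_isTranscendenceBasis_sum {k F : Type*} [Field k] [Field F] [Algebra k F] {q : ℕ}
    (hqn : (∃ x : ℕ → F, IsTranscendenceBasis k x) ∨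
      ∃ m : ℕ, q ≤ m ∧ ∃ x : Fin m → F, IsTranscendenceBasis k x) :
    ∃ (κ : Type) (z : Fin q ⊕ κ → F), IsTranscendenceBasis k z := by
  obtain ⟨x, hx⟩ | ⟨m, hm, x, hx⟩ := hqn
  · exact ⟨ℕ, _, (isTranscendenceBasis_equiv (finSumNatEquiv q)).2 hx⟩
  · obtain ⟨l, rfl⟩ := Nat.exists_eq_add_of_le hm
    exact ⟨Fin l, _, (isTranscendenceBasis_equiv finSumFinEquiv).2 hx⟩

/-- Let `k₀ ⊆ k` be a subfield and `1 ≤ q ≤ n`.  For the natural action `ρ` of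
`G = Aut(F/k)` on `Ω^q_{F/k₀}` (characterized by
`σ(f₀ df₁ ∧ … ∧ df_q) = σ(f₀) dσ(f₁) ∧ … ∧ dσ(f_q)`), every `G`-equivariant
additive (equivalently, `ℚ`-linear) endomorphism of `Ω^q_{F/k₀,log}` is
multiplication by a rational number: `End_G(Ω^q_{F/k₀,log}) = ℚ`. -/
theorem statement19 (k₀ k F : Type*) [Field k₀] [Field k] [Field F]
    [Algebra k₀ k] [Algebra k₀ F] [Algebra k F] [IsScalarTower k₀ k F]
    [IsAlgClosed k] [IsAlgClosed F] [CharZero k] [CharZero F]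
    (q : ℕ) (hq : 1 ≤ q)
    (hqn : (∃ x : ℕ → F, IsTranscendenceBasis k x) ∨
      ∃ m : ℕ, q ≤ m ∧ ∃ x : Fin m → F, IsTranscendenceBasis k x)
    (ρ : (F ≃ₐ[k] F) → (↥(⋀[F]^q (Ω[F⁄k₀])) →+ ↥(⋀[F]^q (Ω[F⁄k₀]))))
    (hρ : ∀ (σ : F ≃ₐ[k] F) (f₀ : F) (f : Fin q → F),
      ρ σ (f₀ • wedge F (Ω[F⁄k₀]) q (fun i => KaehlerDifferential.D k₀ F (f i))) =
        σ f₀ • wedge F (Ω[F⁄k₀]) q (fun i => KaehlerDifferential.D k₀ F (σ (f i))))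
    (φ : ↥(logForms k₀ F q) →+ ↥(logForms k₀ F q))
    (hφ : ∀ (σ : F ≃ₐ[k] F) (ω : ↥(logForms k₀ F q))
      (h₁ : ρ σ ↑ω ∈ logForms k₀ F q) (h₂ : ρ σ ↑(φ ω) ∈ logForms k₀ F q),
        φ ⟨ρ σ ↑ω, h₁⟩ = ⟨ρ σ ↑(φ ω), h₂⟩) :
    ∃ c : ℚ, ∀ ω : ↥(logForms k₀ F q),
      (↑(φ ω) : ↥(⋀[F]^q (Ω[F⁄k₀]))) = (c : F) • (↑ω : ↥(⋀[F]^q (Ω[F⁄k₀]))) := by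
  obtain ⟨κ, z, hz⟩ := exists_isTranscendenceBasis_sum hqn
  have hT (σ : F ≃ₐ[k] F) {ω} (hω : ω ∈ logForms k₀ F q) : ρ σ ω ∈ logForms k₀ F q :=
    map_mem_logForms (σ := σ.restrictScalars k₀) (hρ σ) hω
  have hρω (σ : F ≃ₐ[k] F) (c : F) (f : Fin q → F) :
      ρ σ (c • dlogWedge k₀ f) = σ c • dlogWedge k₀ (σ ∘ f) :=
    map_smul_dlogWedge (σ := σ.restrictScalars k₀) (hρ σ) c f
  have hφ' (σ : F ≃ₐ[k] F) (ω ω' : logForms k₀ F q)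
      (h : ρ σ (ω : ⋀[F]^q (Ω[F⁄k₀])) = (ω' : ⋀[F]^q (Ω[F⁄k₀]))) :
      ρ σ (φ ω : ⋀[F]^q (Ω[F⁄k₀])) = (φ ω' : ⋀[F]^q (Ω[F⁄k₀])) := by
    have h1 := hφ σ ω (hT σ ω.2) (hT σ (φ ω).2)
    have h2 : (⟨ρ σ ω, hT σ ω.2⟩ : logForms k₀ F q) = ω' := Subtype.ext h
    rw [h2] at h1
    exact (congrArg Subtype.val h1).symm
  have hmem {f : Fin q → F} (hf : ∀ i, f i ≠ 0) : dlogWedge k₀ f ∈ logForms k₀ F q := by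
    simpa using smul_dlogWedge_mem_logForms (k₀ := k₀) 1 hf
  let x : logForms k₀ F q := ⟨dlogWedge k₀ (z ∘ Sum.inl), hmem fun i => hz.1.ne_zero _⟩
  obtain ⟨r, hr⟩ := exists_eq_smul_dlogWedge hz hρ (φ x).2 fun σ n h => by
    rw [hφ' σ x (n • x) (by rw [AddSubgroup.coe_nsmul, ← Nat.cast_smul_eq_nsmul F]; exact h),
      map_nsmul, AddSubgroup.coe_nsmul, Nat.cast_smul_eq_nsmul F]
  refine ⟨r, fun ω => ?_⟩
  let H : AddSubgroup ↥(⋀[F]^q (Ω[F⁄k₀])) :=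
    (((logForms k₀ F q).subtype.comp φ).eqLocus
      ((DistribSMul.toAddMonoidHom _ (r : F)).comp (logForms k₀ F q).subtype)).map
        (logForms k₀ F q).subtype
  suffices logForms k₀ F q ≤ H by
    obtain ⟨ω', h, h'⟩ := this ω.2
    obtain rfl : ω' = ω := Subtype.ext h'
    exact h
  refine (AddSubgroup.closure_le _).2 ?_
  rintro _ ⟨c, f, hf, rfl⟩
  refine smul_dlogWedge_mem_of_algebraicIndependent hz (H := H) (c := (c : F)) (fun f hf => ?_) hf
  have hf0 (i : Fin q) : f i ≠ 0 := hf.ne_zero i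
  obtain ⟨σ, hσ⟩ := hz.exists_algEquiv_of_algebraicIndependent hf
  refine ⟨⟨_, smul_dlogWedge_mem_logForms c hf0⟩, ?_, rfl⟩
  let y : logForms k₀ F q := ⟨dlogWedge k₀ f, hmem hf0⟩
  have hy : (φ y : ⋀[F]^q (Ω[F⁄k₀])) = (r : F) • dlogWedge k₀ f := by
    have hσz : σ ∘ z ∘ Sum.inl = f := funext hσ
    rw [← hφ' σ x y (by simpa [hσz] using hρω σ 1 (z ∘ Sum.inl)), hr, hρω, map_ratCast, hσz]
  let yc : logForms k₀ F q := ⟨(c : F) • dlogWedge k₀ f, smul_dlogWedge_mem_logForms c hf0⟩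
  have hyc : c.den • yc = c.num • y := by
    refine Subtype.ext ?_
    rw [AddSubgroup.coe_nsmul, AddSubgroup.coe_zsmul, ← Nat.cast_smul_eq_nsmul F,
      ← Int.cast_smul_eq_zsmul F, smul_smul]
    congr 1
    exact_mod_cast Rat.den_mul_eq_num c
  have hden : (c.den : F) ≠ 0 := Nat.cast_ne_zero.2 c.den_ne_zero
  change (φ yc : ⋀[F]^q (Ω[F⁄k₀])) = (r : F) • (c : F) • dlogWedge k₀ f
  refine smul_right_injective _ hden ?_
  have h1 := congrArg (fun ω => (φ ω : ⋀[F]^q (Ω[F⁄k₀]))) hyc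
  simp only [map_nsmul, map_zsmul, AddSubgroup.coe_nsmul, AddSubgroup.coe_zsmul, hy] at h1
  simp only [Nat.cast_smul_eq_nsmul, h1, ← Int.cast_smul_eq_zsmul F]
  rw [← Nat.cast_smul_eq_nsmul F, smul_smul, smul_smul, smul_smul]
  congr 1
  have h2 : (c.den : F) * c = c.num := by exact_mod_cast Rat.den_mul_eq_num c
  linear_combination -(r : F) * h2
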